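/- arXiv:1104.2763 — 6 statements merged into one kernel-verified Lean document; each statement's English description precedes it below -/
import Mathlib

section
/- The assignment a∧b∧c∧d ↦ (a∧b)↔(c∧d) − (a∧c)↔(b∧d) + (a∧d)↔(b∧c) defines a well-defined injective group homomorphism from Λ⁴H into Λ²H⊗Λ²H, whose image is contained in the subgroup Λ²H↔Λ²H (the image of S²Λ²H under x·y ↦ x↔y), and hence in the symmetric part (Λ²H⊗Λ²H)^{𝔖₂}. -/
/-!
STATEMENT 1: For a finitely generated free abelian group `H`, the assignment
`a∧b∧c∧d ↦ (a∧b)↔(c∧d) − (a∧c)↔(b∧d) + (a∧d)↔(b∧c)` (where `x↔y := x⊗y + y⊗x`)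
defines a well-defined injective group homomorphism `Λ⁴H → Λ²H ⊗ Λ²H` whose image is
contained in `Λ²H ↔ Λ²H` (the image of `S²Λ²H` under `x·y ↦ x↔y`), hence in the
symmetric part `(Λ²H ⊗ Λ²H)^{𝔖₂}`.
-/

open TensorProduct

set_option synthInstance.maxHeartbeats 1000000
set_option maxHeartbeats 1000000

variable (H : Type) [AddCommGroup H] [Module ℤ H]

/-- The second exterior power `Λ²H` of `H` over `ℤ`. -/
abbrev Lambda2 : Submodule ℤ (ExteriorAlgebra ℤ H) := ⋀[ℤ]^2 H

/-- The fourth exterior power `Λ⁴H` of `H` over `ℤ`. -/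
abbrev Lambda4 : Submodule ℤ (ExteriorAlgebra ℤ H) := ⋀[ℤ]^4 H

/-- The wedge product `a ∧ b` as an element of `Λ²H`. -/
noncomputable def wedge (a b : H) : Lambda2 H :=
  ⟨ExteriorAlgebra.ιMulti ℤ 2 ![a, b],
    ExteriorAlgebra.ιMulti_range ℤ 2 (Set.mem_range_self _)⟩

/-- The wedge product `a ∧ b ∧ c ∧ d` as an element of `Λ⁴H`. -/
noncomputable def wedge4 (a b c d : H) : Lambda4 H :=
  ⟨ExteriorAlgebra.ιMulti ℤ 4 ![a, b, c, d],
    ExteriorAlgebra.ιMulti_range ℤ 4 (Set.mem_range_self _)⟩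

/-- The tensor product `Λ²H ⊗ Λ²H` over `ℤ`. -/
abbrev TT := (Lambda2 H) ⊗[ℤ] (Lambda2 H)

/-- `x ↔ y := x⊗y + y⊗x` in `Λ²H ⊗ Λ²H`. -/
noncomputable def hh (x y : Lambda2 H) : TT H := x ⊗ₜ[ℤ] y + y ⊗ₜ[ℤ] x

/-- The subgroup `(Λ²H ⊗ Λ²H)^{𝔖₂}` of tensors fixed by the involution swapping the factors. -/
noncomputable def SymT : Submodule ℤ (TT H) :=
  LinearMap.eqLocus (TensorProduct.comm ℤ (Lambda2 H) (Lambda2 H)).toLinearMap LinearMap.id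

/-- The subgroup `Λ²H ↔ Λ²H` of `Λ²H ⊗ Λ²H`: the image of `S²Λ²H` under `x·y ↦ x↔y`,
i.e. the additive subgroup generated by all elements `x⊗y + y⊗x`. -/
noncomputable def hhSubgroup : AddSubgroup (TT H) :=
  AddSubgroup.closure {t : TT H | ∃ x y : Lambda2 H, t = hh H x y}

lemma msmul_eq {M : Type*} [AddCommGroup M] (inst : Module ℤ M) (r : ℤ) (x : M) :
    inst.toSMul.smul r x = r • x := int_smul_eq_zsmul inst r x

lemma wedge_eq (a b : H) : wedge H a b = exteriorPower.ιMulti ℤ 2 ![a, b] := rfl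
lemma wedge4_eq (a b c d : H) : wedge4 H a b c d = exteriorPower.ιMulti ℤ 4 ![a, b, c, d] := rfl

lemma wedge_coe (a b : H) : (wedge H a b : ExteriorAlgebra ℤ H) =
    ExteriorAlgebra.ι ℤ a * ExteriorAlgebra.ι ℤ b := by
  simp [wedge, ExteriorAlgebra.ιMulti_apply]

lemma wedge4_coe (a b c d : H) : (wedge4 H a b c d : ExteriorAlgebra ℤ H) =
    ExteriorAlgebra.ι ℤ a * ExteriorAlgebra.ι ℤ b * ExteriorAlgebra.ι ℤ c
      * ExteriorAlgebra.ι ℤ d := by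
  simp [wedge4, ExteriorAlgebra.ιMulti_apply, Fin.succ, mul_assoc]

lemma wedge_add_left (a a' b : H) : wedge H (a + a') b = wedge H a b + wedge H a' b := by
  apply Subtype.ext; simp [wedge_coe, add_mul]
lemma wedge_add_right (a b b' : H) : wedge H a (b + b') = wedge H a b + wedge H a b' := by
  apply Subtype.ext; simp [wedge_coe, mul_add]
lemma wedge_smul_left (r : ℤ) (a b : H) : wedge H (r • a) b = r • wedge H a b := by
  apply Subtype.ext
  have h : (((r • wedge H a b : Lambda2 H)) : ExteriorAlgebra ℤ H) =
      r • (wedge H a b : ExteriorAlgebra ℤ H) := map_zsmul (Lambda2 H).subtype.toAddMonoidHom r _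
  rw [h, wedge_coe, wedge_coe, map_zsmul, smul_mul_assoc]
lemma wedge_smul_right (r : ℤ) (a b : H) : wedge H a (r • b) = r • wedge H a b := by
  apply Subtype.ext
  have h : (((r • wedge H a b : Lambda2 H)) : ExteriorAlgebra ℤ H) =
      r • (wedge H a b : ExteriorAlgebra ℤ H) := map_zsmul (Lambda2 H).subtype.toAddMonoidHom r _
  rw [h, wedge_coe, wedge_coe, map_zsmul, mul_smul_comm]
lemma wedge_self (a : H) : wedge H a a = 0 := by
  apply Subtype.ext; simp [wedge_coe]
lemma wedge_swap (a b : H) : wedge H a b = - wedge H b a := by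
  have h := wedge_self H (a + b)
  rw [wedge_add_left, wedge_add_right, wedge_add_right, wedge_self, wedge_self] at h
  rw [eq_neg_iff_add_eq_zero]; simpa using h

lemma hh_add_left (x x' y : Lambda2 H) : hh H (x + x') y = hh H x y + hh H x' y := by
  simp only [hh, add_tmul, tmul_add]; abel
lemma hh_add_right (x y y' : Lambda2 H) : hh H x (y + y') = hh H x y + hh H x y' := by
  simp only [hh, add_tmul, tmul_add]; abel
lemma hh_smul_left (r : ℤ) (x y : Lambda2 H) : hh H (r • x) y = r • hh H x y := by
  simp only [hh, smul_add, tmul_smul, smul_tmul']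
lemma hh_smul_right (r : ℤ) (x y : Lambda2 H) : hh H x (r • y) = r • hh H x y := by
  simp only [hh, smul_add, tmul_smul, smul_tmul']
lemma hh_neg_left (x y : Lambda2 H) : hh H (-x) y = - hh H x y := by
  simp only [hh, neg_tmul, tmul_neg]; abel
lemma hh_neg_right (x y : Lambda2 H) : hh H x (-y) = - hh H x y := by
  simp only [hh, neg_tmul, tmul_neg]; abel
lemma hh_zero_left (x : Lambda2 H) : hh H 0 x = 0 := by simp [hh]
lemma hh_zero_right (x : Lambda2 H) : hh H x 0 = 0 := by simp [hh]
lemma hh_comm (x y : Lambda2 H) : hh H x y = hh H y x := by simp only [hh]; abel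

noncomputable def jfun (a b c d : H) : TT H :=
  hh H (wedge H a b) (wedge H c d) - hh H (wedge H a c) (wedge H b d)
            + hh H (wedge H a d) (wedge H b c)

lemma jfun_smul (v : Fin 4 → H) (i : Fin 4) (r : ℤ) (x y : H) (hy : y = r • x) :
    jfun H (Function.update v i y 0) (Function.update v i y 1) (Function.update v i y 2)
        (Function.update v i y 3) =
      r • jfun H (Function.update v i x 0) (Function.update v i x 1) (Function.update v i x 2)
        (Function.update v i x 3) := by
  have e1 : ∀ z, wedge H y z = r • wedge H x z := fun z => by rw [hy, wedge_smul_left]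
  have e2 : ∀ z, wedge H z y = r • wedge H z x := fun z => by rw [hy, wedge_smul_right]
  clear hy
  fin_cases i <;>
  simp [jfun, Function.update, e1, e2, hh_smul_left, hh_smul_right, smul_add, smul_sub]

noncomputable def jmul : MultilinearMap ℤ (fun _ : Fin 4 => H) (TT H) :=
  MultilinearMap.mk' (fun v => jfun H (v 0) (v 1) (v 2) (v 3))
    (by
      intro v i x y
      fin_cases i <;>
      simp [jfun, Function.update, wedge_add_left, wedge_add_right, hh_add_left, hh_add_right] <;>
      abel)
    (by
      intro v i r x
      refine jfun_smul H v i r x _ (msmul_eq _ r x))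

noncomputable def jalt : H [⋀^Fin 4]→ₗ[ℤ] (TT H) :=
  { jmul H with
    map_eq_zero_of_eq' := by
      have key : ∀ (v : Fin 4 → H) (i j : Fin 4), v i = v j → i < j →
          jfun H (v 0) (v 1) (v 2) (v 3) = 0 := by
        intro v i j h hij
        fin_cases i <;> fin_cases j <;> simp at hij <;> simp at h <;>
          simp only [jfun, h, wedge_self, hh_zero_left, hh_zero_right]
        · rw [hh_comm H (wedge H (v 1) (v 2))]; abel
        · rw [hh_comm H (wedge H (v 2) (v 3)), wedge_swap H (v 1) (v 2), hh_neg_left]; abel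
        · rw [hh_comm H (wedge H (v 3) (v 1)), wedge_swap H (v 3) (v 1), wedge_swap H (v 2) (v 3),
            hh_neg_left, hh_neg_right]; abel
        · abel
        · rw [wedge_swap H (v 2) (v 3), hh_neg_right]; abel
        · abel
      intro v i j h hij
      rcases lt_or_gt_of_ne hij with h' | h'
      · exact key v i j h h'
      · exact key v j i h.symm h' }

noncomputable def jlin : Lambda4 H →+ TT H :=
  (exteriorPower.alternatingMapLinearEquiv (jalt H)).toAddMonoidHom

lemma jlin_wedge4 (a b c d : H) : jlin H (wedge4 H a b c d) = jfun H a b c d :=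
  exteriorPower.alternatingMapLinearEquiv_apply_ιMulti (jalt H) ![a, b, c, d]

lemma wedge4_span : AddSubgroup.closure {x | ∃ a b c d, x = wedge4 H a b c d} = ⊤ := by
  rw [eq_top_iff]
  intro x _
  have hx : x ∈ Submodule.span ℤ (Set.range (exteriorPower.ιMulti ℤ 4 (M := H))) :=
    (exteriorPower.ιMulti_span ℤ 4 H) ▸ Submodule.mem_top
  induction hx using Submodule.span_induction with
  | mem x h =>
    obtain ⟨v, rfl⟩ := h
    apply AddSubgroup.subset_closure
    refine ⟨v 0, v 1, v 2, v 3, ?_⟩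
    rw [wedge4_eq]
    congr 1
    ext i; fin_cases i <;> rfl
  | zero => exact zero_mem _
  | add x y _ _ hx hy => exact add_mem (hx trivial) (hy trivial)
  | smul r x _ hx =>
    have e := msmul_eq (Submodule.module (Lambda4 H)) r x
    have h := AddSubgroup.zsmul_mem _ (hx trivial) r
    rw [← e] at h
    exact h

/-- the multiplication map -/
noncomputable def mulmap : TT H →+ ExteriorAlgebra ℤ H :=
  TensorProduct.liftAddHom
    (((AddMonoidHom.mul (R := ExteriorAlgebra ℤ H)).compl₂ (Lambda2 H).subtype.toAddMonoidHom).comp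
      (Lambda2 H).subtype.toAddMonoidHom) (by
      intro r m n
      rw [map_zsmul, map_zsmul]; rfl)

lemma mulmap_tmul (x y : Lambda2 H) : mulmap H (x ⊗ₜ[ℤ] y) = (x * y : ExteriorAlgebra ℤ H) := by
  rfl

lemma six_aux {M : Type*} [AddCommGroup M] [inst : Module ℤ M] [Module.Free ℤ M] (x : M)
    (h : (6 : ℕ) • x = 0) : x = 0 := by
  obtain rfl : inst = AddCommGroup.toIntModule M := Subsingleton.elim _ _
  have h' : (6 : ℤ) • x = 0 := by exact_mod_cast h
  have : Module.IsTorsionFree ℤ M := inferInstance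
  exact ((smul_eq_zero (R := ℤ) (M := M)).mp h').resolve_left (by norm_num)

lemma mulmap_jfun (a b c d : H) :
    mulmap H (jfun H a b c d) = (6 : ℕ) • (wedge4 H a b c d : ExteriorAlgebra ℤ H) := by
  simp only [jfun, hh, map_add, map_sub, mulmap_tmul, wedge_coe, wedge4_coe]
  have sw : ∀ x y : H, ExteriorAlgebra.ι ℤ x * ExteriorAlgebra.ι ℤ y =
      - (ExteriorAlgebra.ι ℤ y * ExteriorAlgebra.ι ℤ x) := fun x y =>
    eq_neg_of_add_eq_zero_left (ExteriorAlgebra.ι_add_mul_swap x y)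
  have sw' : ∀ (x y : H) (z : ExteriorAlgebra ℤ H),
      ExteriorAlgebra.ι ℤ x * (ExteriorAlgebra.ι ℤ y * z) =
      - (ExteriorAlgebra.ι ℤ y * (ExteriorAlgebra.ι ℤ x * z)) := fun x y z => by
    rw [← mul_assoc, sw, neg_mul, mul_assoc]
  simp only [mul_assoc, sw b a, sw c a, sw d a, sw c b, sw d b, sw d c,
    sw' b a, sw' c a, sw' d a, sw' c b, sw' d b, sw' d c, mul_neg, neg_neg]
  abel

theorem statement1 [Module.Free ℤ H] [Module.Finite ℤ H] :
    ∃ j : Lambda4 H →+ TT H,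
      (∀ a b c d : H,
        j (wedge4 H a b c d) =
          hh H (wedge H a b) (wedge H c d) - hh H (wedge H a c) (wedge H b d)
            + hh H (wedge H a d) (wedge H b c)) ∧
      Function.Injective j ∧
      (∀ x : Lambda4 H, j x ∈ hhSubgroup H) ∧
      (∀ x : Lambda4 H, j x ∈ SymT H) := by
  have hmem : ∀ x : Lambda4 H, jlin H x ∈ hhSubgroup H := by
    intro x
    have hx : x ∈ AddSubgroup.closure {x | ∃ a b c d, x = wedge4 H a b c d} := by
      rw [wedge4_span]; trivial
    induction hx using AddSubgroup.closure_induction with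
    | mem x h =>
      obtain ⟨a, b, c, d, rfl⟩ := h
      rw [jlin_wedge4, jfun]
      have hg : ∀ x y, hh H x y ∈ hhSubgroup H := fun x y =>
        AddSubgroup.subset_closure ⟨x, y, rfl⟩
      exact add_mem (sub_mem (hg _ _) (hg _ _)) (hg _ _)
    | zero => rw [map_zero]; exact zero_mem _
    | add x y _ _ hx hy => rw [map_add]; exact add_mem hx hy
    | neg x _ hx => rw [map_neg]; exact neg_mem hx
  refine ⟨jlin H, ?_, ?_, hmem, ?_⟩
  · exact jlin_wedge4 H
  · rw [injective_iff_map_eq_zero]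
    intro x hx
    have hx : jlin H x = 0 := hx
    have h6 : (mulmap H).comp (jlin H) = (6 : ℕ) • (Lambda4 H).subtype.toAddMonoidHom := by
      apply AddMonoidHom.eq_of_eqOn_dense (wedge4_span H)
      rintro _ ⟨a, b, c, d, rfl⟩
      rw [AddMonoidHom.comp_apply, jlin_wedge4, mulmap_jfun]; rfl
    have h := DFunLike.congr_fun h6 x
    rw [AddMonoidHom.comp_apply, hx, map_zero] at h
    have h' : (6 : ℕ) • x = 0 := Subtype.ext h.symm
    have hf : @Module.Free ℤ (Lambda4 H) _ _ (Submodule.module _) :=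
      exteriorPower.instFree ℤ 4 (M := H)
    exact @six_aux (Lambda4 H) _ (Submodule.module _) hf x h'
  · intro x
    have : hhSubgroup H ≤ (SymT H).toAddSubgroup := by
      rw [hhSubgroup, AddSubgroup.closure_le]
      rintro _ ⟨x, y, rfl⟩
      change TensorProduct.comm ℤ (Lambda2 H) (Lambda2 H) (hh H x y) = hh H x y
      rw [hh, map_add, TensorProduct.comm_tmul, TensorProduct.comm_tmul, add_comm]
    exact this (hmem x)
end

section
/- The quotient group S²Λ²H / w(Λ⁴H) is torsion-free, where w: Λ⁴H → S²Λ²H is the homomorphism sending a∧b∧c∧d to (a∧b)·(c∧d) − (a∧c)·(b∧d) + (a∧d)·(b∧c). -/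
/-!
STATEMENT 3: For a finitely generated free abelian group `H`, the quotient group
`S²Λ²H / w(Λ⁴H)` is torsion-free, where `w : Λ⁴H → S²Λ²H` is the homomorphism sending
`a∧b∧c∧d` to `(a∧b)·(c∧d) − (a∧c)·(b∧d) + (a∧d)·(b∧c)`.
-/

open TensorProduct

set_option synthInstance.maxHeartbeats 1000000
set_option maxHeartbeats 1000000

variable (H : Type) [AddCommGroup H] [Module ℤ H]

/-- The submodule of `Λ²H ⊗ Λ²H` generated by the elements `x⊗y - y⊗x`. -/
noncomputable def symRel : Submodule ℤ (TT H) :=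
  Submodule.span ℤ {z : TT H | ∃ x y : Lambda2 H, z = x ⊗ₜ[ℤ] y - y ⊗ₜ[ℤ] x}

/-- The second symmetric power `S²Λ²H`: quotient of `Λ²H ⊗ Λ²H` by all `x⊗y - y⊗x`. -/
abbrev Sym2L := TT H ⧸ symRel H

/-- The product `x·y` in `S²Λ²H`, i.e. the class of `x ⊗ y`. -/
noncomputable def symProd (x y : Lambda2 H) : Sym2L H :=
  Submodule.Quotient.mk (x ⊗ₜ[ℤ] y)

section abstractPart

/-- strictly increasing pairs of indices -/
abbrev PairIdx (n : ℕ) := {p : Fin n × Fin n // p.1 < p.2}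

/-- increasing pairs are order embeddings of `Fin 2` -/
noncomputable def pairEquiv (n : ℕ) : (Fin 2 ↪o Fin n) ≃ PairIdx n where
  toFun f := ⟨(f 0, f 1), f.strictMono (by decide)⟩
  invFun p := OrderEmbedding.ofStrictMono ![p.1.1, p.1.2] (by
    intro i j hij
    fin_cases i <;> fin_cases j <;> simp_all
    exact p.2)
  left_inv f := by
    ext i
    fin_cases i <;> rfl
  right_inv p := rfl

/-- A basis for any `ℤ`-module structure gives one for the canonical structure. -/
lemma exists_basis_int {P M : Type*} [AddCommGroup M] (i : Module ℤ M)
    (B : @Module.Basis P ℤ M _ _ i) :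
    ∃ B' : @Module.Basis P ℤ M _ _ (AddCommGroup.toIntModule M), ∀ p, B' p = B p := by
  obtain rfl : i = AddCommGroup.toIntModule M := Subsingleton.elim _ _
  exact ⟨B, fun _ => rfl⟩

lemma closure_basis {P M : Type*} [AddCommGroup M] (B : Module.Basis P ℤ M) :
    AddSubgroup.closure (Set.range B) = ⊤ := by
  rw [← Submodule.span_int_eq_addSubgroupClosure, B.span_eq]
  rfl

lemma hom_tensor_comm {P M A : Type*} [AddCommGroup M] [AddCommGroup A] (B : Module.Basis P ℤ M)
    (f : M ⊗[ℤ] M →+ A) (h : ∀ p q, f (B p ⊗ₜ B q) = f (B q ⊗ₜ B p)) (x y : M) :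
    f (x ⊗ₜ y) = f (y ⊗ₜ x) := by
  have hx : x ∈ AddSubgroup.closure (Set.range B) := by rw [closure_basis]; trivial
  have hy : y ∈ AddSubgroup.closure (Set.range B) := by rw [closure_basis]; trivial
  induction hx using AddSubgroup.closure_induction with
  | zero => simp
  | add x x' _ _ h1 h2 => rw [add_tmul, tmul_add, map_add, map_add, h1, h2]
  | neg x _ h1 => rw [neg_tmul, tmul_neg, map_neg, map_neg, h1]
  | mem x hx =>
    obtain ⟨p, rfl⟩ := hx
    induction hy using AddSubgroup.closure_induction with
    | zero => simp
    | add x x' _ _ h1 h2 => rw [add_tmul, tmul_add, map_add, map_add, h1, h2]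
    | neg x _ h1 => rw [neg_tmul, tmul_neg, map_neg, map_neg, h1]
    | mem y hy =>
      obtain ⟨q, rfl⟩ := hy
      exact h p q

variable {n : ℕ} {T : Type*} [AddCommGroup T] (t : Fin n → Fin n → Fin n → Fin n → T)

/-- normal form of a basis tensor -/
def nf (p q : PairIdx n) : T :=
  if p.1.2 < q.1.1 then t p.1.1 q.1.1 p.1.2 q.1.2 - t p.1.1 q.1.2 p.1.2 q.1.1
  else if q.1.2 < p.1.1 then t q.1.1 p.1.1 q.1.2 p.1.2 - t q.1.1 p.1.2 q.1.2 p.1.1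
  else if p.1.1 < q.1.1 ∨ (p.1.1 = q.1.1 ∧ p.1.2 ≤ q.1.2) then t p.1.1 p.1.2 q.1.1 q.1.2
  else t q.1.1 q.1.2 p.1.1 p.1.2

lemma nf_comm (p q : PairIdx n) : nf t p q = nf t q p := by
  obtain ⟨⟨i, j⟩, h⟩ := p
  obtain ⟨⟨k, l⟩, h'⟩ := q
  dsimp only at h h'
  simp only [nf]
  by_cases a1 : j < k
  · have a2 : ¬ l < i := by omega
    simp [a1, a2]
  by_cases a2 : l < i
  · simp [a1, a2]
  simp only [a1, a2, if_false]
  rcases lt_trichotomy i k with h1 | rfl | h1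
  · have : ¬ k < i := by omega
    have : ¬ k = i := by omega
    simp [*]
  · rcases lt_trichotomy j l with h2 | rfl | h2
    · have : ¬ l ≤ j := by omega
      simp [*, h2.le]
    · rfl
    · have : ¬ j ≤ l := by omega
      simp [*, h2.le]
  · have : ¬ i < k := by omega
    have : ¬ i = k := by omega
    simp [*]

lemma abstract_main {L S : Type*} [AddCommGroup L] [AddCommGroup S]
    (B : Module.Basis (PairIdx n × PairIdx n) ℤ T)
    (hB : ∀ p q, B (p, q) = t p.1.1 p.1.2 q.1.1 q.1.2)
    (mk : T →+ S) (hsurj : Function.Surjective mk)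
    (hcomm : ∀ i j k l, mk (t i j k l) = mk (t k l i j))
    (hker : ∀ f : T →+ T, (∀ p q, f (B (p, q)) = f (B (q, p))) → ∀ u, mk u = 0 → f u = 0)
    (e : Fin n → Fin n → Fin n → Fin n → L)
    (he : AddSubgroup.closure {z : L | ∃ i j k l : Fin n, i < j ∧ j < k ∧ k < l ∧
      z = e i j k l} = ⊤)
    (w : L →+ S)
    (hw : ∀ i j k l, w (e i j k l) = mk (t i j k l) - mk (t i k j l) + mk (t i l j k))
    (y : S) (k : ℤ) (hk : k ≠ 0) (h : k • y ∈ w.range) : y ∈ w.range := by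
  let φ : T →+ T := (B.constr ℤ (fun pq => nf t pq.1 pq.2)).toAddMonoidHom
  have hφ : ∀ p q, φ (B (p, q)) = nf t p q := fun p q =>
    B.constr_basis ℤ (fun pq => nf t pq.1 pq.2) (p, q)
  have hφt : ∀ i j k l (h : i < j) (h' : k < l), φ (t i j k l) =
      nf t ⟨(i, j), h⟩ ⟨(k, l), h'⟩ := by
    intro i j k l h h'
    rw [← hφ, hB]
  have hφker := hker φ (fun p q => by rw [hφ, hφ, nf_comm])
  -- every class in the range of `w` has normal form zero
  have key1 : ∀ z u, mk u = w z → φ u = 0 := by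
    intro z
    have hz : z ∈ AddSubgroup.closure {z : L | ∃ i j k l : Fin n, i < j ∧ j < k ∧ k < l ∧
      z = e i j k l} := by rw [he]; trivial
    induction hz using AddSubgroup.closure_induction with
    | zero =>
      intro u hu
      exact hφker u (by rw [hu, map_zero])
    | add x y _ _ hx hy =>
      intro u hu
      obtain ⟨a, ha⟩ := hsurj (w x)
      have := hy (u - a) (by rw [map_sub, hu, map_add, ha]; abel)
      rwa [map_sub, hx a ha, sub_zero] at this
    | neg x _ hx =>
      intro u hu
      have := hx (-u) (by rw [map_neg, hu, map_neg, neg_neg])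
      rwa [map_neg, neg_eq_zero] at this
    | mem z hz =>
      intro u hu
      obtain ⟨i, j, k, l, h1, h2, h3, rfl⟩ := hz
      have h0 : φ (u - (t i j k l - t i k j l + t i l j k)) = 0 := by
        apply hφker
        rw [map_sub, hu, hw, map_add, map_sub, sub_self]
      rw [map_sub, sub_eq_zero] at h0
      rw [h0, map_add, map_sub, hφt i j k l h1 h3, hφt i k j l (h1.trans h2) (h2.trans h3),
        hφt i l j k (h1.trans (h2.trans h3)) h2]
      have e1 : ¬ (k < j) := by omega
      have e2 : ¬ (l < i) := by omega
      have e3 : ¬ (l < j) := by omega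
      have e4 : ¬ (k < i) := by omega
      simp only [nf, h1, h2, e1, e2, e3, e4, if_true, if_false, true_or]
      abel
  have key2 : ∀ u, mk (u - φ u) ∈ w.range := by
    intro u
    have hu : u ∈ AddSubgroup.closure (Set.range B) := by rw [closure_basis]; trivial
    induction hu using AddSubgroup.closure_induction with
    | zero => simp
    | add x y _ _ hx hy =>
      rw [map_add, add_sub_add_comm, map_add]
      exact add_mem hx hy
    | neg x _ hx =>
      rw [map_neg, ← neg_sub', map_neg]
      exact neg_mem hx
    | mem z hz =>
      obtain ⟨⟨p, q⟩, rfl⟩ := hz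
      rw [hφ, hB, nf]
      split_ifs with h1 h2 h3
      · refine ⟨e p.1.1 p.1.2 q.1.1 q.1.2, ?_⟩
        rw [hw, map_sub, map_sub]
        abel
      · refine ⟨e q.1.1 q.1.2 p.1.1 p.1.2, ?_⟩
        rw [hw, map_sub, map_sub, hcomm q.1.1 q.1.2]
        abel
      · rw [sub_self, map_zero]
        exact zero_mem _
      · rw [map_sub, hcomm, sub_self]
        exact zero_mem _
  obtain ⟨u, rfl⟩ := hsurj y
  obtain ⟨z, hz⟩ := h
  have h0 : k • φ u = 0 := by
    rw [← map_zsmul]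
    exact key1 z _ (by rw [map_zsmul, hz])
  have h1 : φ u = 0 := by
    apply B.ext_elem
    intro i
    have := congrArg (fun u => B.repr u i) h0
    simp only [map_zsmul, map_zero, Finsupp.smul_apply, Finsupp.zero_apply, smul_eq_mul,
      mul_eq_zero] at this
    rw [map_zero, Finsupp.zero_apply]
    exact this.resolve_left hk
  have h2 := key2 u
  rwa [h1, sub_zero] at h2

end abstractPart

section helpers

variable {H} {n : ℕ} (b : Module.Basis (Fin n) ℤ H)

lemma exists_basis2 : ∃ B : @Module.Basis (PairIdx n) ℤ (Lambda2 H) _ _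
    (AddCommGroup.toIntModule _), ∀ p, B p = wedge H (b p.1.1) (b p.1.2) := by
  obtain ⟨B, hB⟩ := exists_basis_int _ ((b.exteriorPower 2).reindex
    (Set.powersetCard.ofFinEmbEquiv.symm.trans (pairEquiv n)))
  refine ⟨B, fun p => ?_⟩
  rw [hB, Module.Basis.reindex_apply, exteriorPower.basis_apply]
  apply Subtype.ext
  rw [exteriorPower.ιMulti_family_apply_coe]
  simp only [wedge, ExteriorAlgebra.ιMulti_family]
  congr 1
  ext i
  fin_cases i <;> simp [pairEquiv] <;> rfl

lemma closure4 : AddSubgroup.closure {z : Lambda4 H | ∃ i j k l : Fin n, i < j ∧ j < k ∧ k < l ∧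
    z = wedge4 H (b i) (b j) (b k) (b l)} = ⊤ := by
  obtain ⟨B, hB⟩ := exists_basis_int _ (b.exteriorPower 4)
  rw [eq_top_iff, ← closure_basis B]
  apply AddSubgroup.closure_mono
  rintro _ ⟨s, rfl⟩
  set f := Set.powersetCard.ofFinEmbEquiv.symm s with hf
  refine ⟨f 0, f 1, f 2, f 3, f.strictMono (by decide), f.strictMono (by decide),
    f.strictMono (by decide), ?_⟩
  rw [hB, exteriorPower.basis_apply]
  apply Subtype.ext
  rw [exteriorPower.ιMulti_family_apply_coe]
  simp only [wedge4, ExteriorAlgebra.ιMulti_family]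
  congr 1
  ext i
  fin_cases i <;> simp [hf]

lemma symProd_comm (x y : Lambda2 H) : symProd H x y = symProd H y x := by
  rw [symProd, symProd, Submodule.Quotient.eq]
  exact Submodule.subset_span ⟨x, y, rfl⟩

end helpers

theorem statement3 [Module.Free ℤ H] [Module.Finite ℤ H]
    (w : Lambda4 H →+ Sym2L H)
    (hw : ∀ a b c d : H,
      w (wedge4 H a b c d) =
        symProd H (wedge H a b) (wedge H c d) - symProd H (wedge H a c) (wedge H b d)
          + symProd H (wedge H a d) (wedge H b c)) :
    ∀ (x : Sym2L H ⧸ w.range) (k : ℤ), k ≠ 0 → k • x = 0 → x = 0 := by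
  intro x k hk hx
  obtain ⟨y, rfl⟩ := QuotientAddGroup.mk_surjective x
  rw [QuotientAddGroup.eq_zero_iff]
  have hy : k • y ∈ w.range := by
    rw [← QuotientAddGroup.eq_zero_iff]
    exact hx
  let b := Module.finBasis ℤ H
  obtain ⟨B, hB⟩ := exists_basis2 b
  obtain ⟨BT, hBT⟩ := exists_basis_int _ (B.tensorProduct B)
  have hBT' : ∀ p q, BT (p, q) = B p ⊗ₜ[ℤ] B q := fun p q => by
    rw [hBT, Module.Basis.tensorProduct_apply]
  refine abstract_main
    (fun i j k l => wedge H (b i) (b j) ⊗ₜ[ℤ] wedge H (b k) (b l)) BT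
    (fun p q => by rw [hBT', hB, hB])
    ((symRel H).mkQ.toAddMonoidHom) (Submodule.mkQ_surjective _)
    (fun i j k l => symProd_comm _ _)
    ?_ (fun i j k l => wedge4 H (b i) (b j) (b k) (b l)) (closure4 b) w
    (fun i j k l => hw _ _ _ _) y k hk hy
  intro f hf u hu
  have hu' : u ∈ symRel H := (Submodule.Quotient.mk_eq_zero _).1 hu
  have hcomm := hom_tensor_comm B f (fun p q => by rw [← hBT', hf, hBT'])
  rw [symRel] at hu'
  induction hu' using Submodule.span_induction with
  | zero => exact map_zero f
  | add x y hx hy h1 h2 =>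
    rw [map_add, h1 ((Submodule.Quotient.mk_eq_zero _).2 hx),
      h2 ((Submodule.Quotient.mk_eq_zero _).2 hy), add_zero]
  | smul c x hx h1 =>
    have := h1 ((Submodule.Quotient.mk_eq_zero _).2 hx)
    have h3 : f (c • x) = c • f x := map_zsmul f c x
    rw [h3, this, smul_zero]
  | mem z hz =>
    obtain ⟨x, y, rfl⟩ := hz
    rw [map_sub, hcomm, sub_self]
end

section
/- Let ρ be a rational representation of Sp(2g,ℚ) on ℚᵈ. If L is an additive subgroup of ℚᵈ such that ρ(γ)(L) ⊆ L for every γ ∈ Sp(2g,ℤ), then the ℚ-linear span of L in ℚᵈ is invariant under ρ(M) for every M ∈ Sp(2g,ℚ). -/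
/-!
STATEMENT 7: Let `ρ` be a rational representation of `Sp(2g,ℚ)` on `ℚᵈ`.  If `L` is an
additive subgroup of `ℚᵈ` with `ρ(γ)(L) ⊆ L` for every `γ ∈ Sp(2g,ℤ)`, then the ℚ-linear
span of `L` is invariant under `ρ(M)` for every `M ∈ Sp(2g,ℚ)`.
-/

open Matrix

/-- The symplectic group `Sp(2g,ℚ)` (2g×2g rational matrices `M` with `MᵀJM = J`). -/
abbrev Sp (g : ℕ) := Matrix.symplecticGroup (Fin g) ℚ

/-- An element of `Sp(2g,ℚ)` lies in `Sp(2g,ℤ)` if all its entries are integers. -/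
def IsIntegralSp {g : ℕ} (γ : Sp g) : Prop :=
  ∀ i j, ∃ k : ℤ, (γ : Matrix (Fin g ⊕ Fin g) (Fin g ⊕ Fin g) ℚ) i j = (k : ℚ)

/-- A representation `ρ : Sp(2g,ℚ) → GL(d,ℚ)` is rational if each matrix entry of `ρ(M)`
is given by a fixed polynomial with rational coefficients in the entries of `M`. -/
def IsRationalRep (g d : ℕ) (ρ : Sp g →* GL (Fin d) ℚ) : Prop :=
  ∃ P : Fin d → Fin d → MvPolynomial ((Fin g ⊕ Fin g) × (Fin g ⊕ Fin g)) ℚ,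
    ∀ (M : Sp g) (i j : Fin d),
      ((ρ M : Matrix (Fin d) (Fin d) ℚ) i j) =
        MvPolynomial.eval
          (fun p => (M : Matrix (Fin g ⊕ Fin g) (Fin g ⊕ Fin g) ℚ) p.1 p.2) (P i j)

theorem exists_symm_aux {l : Type*} [DecidableEq l] [Fintype l] {R : Type*} [Field R]
    {A C : Matrix l l R} (hker : ∀ (x : l → R), (A • x = 0) → (C • x = 0) → x = 0)
    (hsymm : Aᵀ * C = Cᵀ * A) :
    ∃ (X : Matrix l l R), X.IsSymm ∧ IsUnit (A + X * C) := by
  -- `C` is transformed into `P = fromBlocks 1 0 0 0` by invertible matrices `V` and `U`.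
  rcases exists_rank_normal_form C with ⟨V, U, s, hV, hU, heq⟩
  set P := V * C * U with P_def; set Q := Vᵀ⁻¹ * A * U with Q_def
  set f := fun (x : Matrix l l R) ↦ x.submatrix s.symm s.symm
  have hf (x) : f x = x.submatrix s.symm s.symm := rfl
  have f_unit {x} : IsUnit x → IsUnit (f x) := (isUnit_submatrix_equiv ..).2
  have f_mul (x y) : f (x * y) = f x * f y := submatrix_mul _ _ _ _ _ s.symm.bijective
  have _ : Invertible V := hV.invertible
  have _ : Invertible U := hU.invertible
  have _ : Invertible (f Vᵀ) := (f_unit (V.isUnit_transpose.2 hV)).invertible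
  -- The hypothesis that the only vector annihilated by both matrices is 0, holds for `P` and `Q`.
  have con1 (x : Fin C.rank ⊕ Fin (Fintype.card l - C.rank) → R)
      (heq1 : (f Q) • x = 0) (heq2 : (f P) • x = 0) : x = 0 := by
    refine (f_unit hU).smul_left_cancel.1 ?_
    rw [f_mul, f_mul, mul_assoc, mul_smul, IsUnit.smul_eq_zero, mul_smul, hf,
      smul_eq_mulVec, submatrix_mulVec_equiv, Equiv.symm_symm] at heq1 heq2
    · rw [Equiv.comp_symm_eq, Pi.zero_comp] at heq1 heq2
      exact s.surjective.injective_comp_right <| by simpa using hker _ heq1 heq2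
    · exact f_unit hV
    · exact f_unit <| isUnit_nonsing_inv_iff.2 <| V.isUnit_transpose.2 hV
  -- The symmetry relation also holds for `P` and `Q`.
  have con2 : Qᵀ * P = Pᵀ * Q := by
    simp only [P_def, mul_assoc, transpose_mul, transpose_nonsing_inv, transpose_transpose, Q_def,
      inv_mul_cancel_left_of_invertible, mul_inv_cancel_left_of_invertible]
    rw [← mul_assoc Aᵀ, hsymm, mul_assoc]
  replace con2 : (f Q).toBlocks₁₁ᵀ = (f Q).toBlocks₁₁ ∧ (f Q).toBlocks₁₂ = 0 := by
    apply_fun reindex s s at con2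
    rw [reindex_apply, reindex_apply, ← hf, ← hf, f_mul, f_mul Pᵀ, heq, hf,
      ← transpose_submatrix, ← hf Q, ← (f Q).fromBlocks_toBlocks, hf (_)ᵀ, hf
      ((fromBlocks 1 0 0 0).submatrix _ _)] at con2
    simp [fromBlocks_transpose, fromBlocks_multiply] at con2; tauto
  -- The lower-right block of `Q` is invertible.
  have con3 : IsUnit (f Q).toBlocks₂₂ := by
    refine mulVec_injective_iff_isUnit.1 ?_
    rw [← coe_mulVecLin, ← LinearMap.ker_eq_bot]
    refine ker_mulVecLin_eq_bot_iff.2 fun x hx ↦ Sum.elim_injective' <|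
      (con1 _ ?_ ?_).trans Sum.elim_zero_zero.symm
    · rw [← (f Q).fromBlocks_toBlocks]; simp [hx, con2.2, fromBlocks_mulVec]
    · simp [hf, heq, fromBlocks_mulVec]
  set Y : Matrix (Fin C.rank ⊕ Fin (Fintype.card l - C.rank)) (Fin C.rank ⊕
    Fin (Fintype.card l - C.rank)) R := fromBlocks (1 - (f Q).toBlocks₁₁) 0 0 0 with Y_def
  have hY_symm : Y.IsSymm := by
    rw [Y_def, isSymm_fromBlocks_iff]
    exact ⟨IsSymm.sub isSymm_one con2.1, by simp⟩
  -- We now take `X = Vᵀ * Y * V` and this gives the desired matrix `X.submatrix s s`.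
  set X := (f Vᵀ) * Y * (f V) with X_def
  refine ⟨X.submatrix s s, IsSymm.submatrix ?_ s, (isUnit_submatrix_equiv s.symm s.symm).1 ?_⟩
  · simp_rw [X_def, Matrix.IsSymm, transpose_mul, hY_symm.eq, hf, transpose_submatrix,
      transpose_transpose, mul_assoc]
  · have heq' : f (A + X.submatrix s s * C) = (f Vᵀ) * (f Q + Y * (f P)) * f (U⁻¹) := by
      simp_rw [hf, submatrix_add, Pi.add_apply, Q_def, P_def, ← hf, f_mul, hf, mul_add, ← mul_assoc,
        ← inv_submatrix_equiv, add_mul, mul_assoc _ (U.submatrix _ _), mul_inv_of_invertible]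
      simp [X_def]; rfl
    rw [← hf, heq', IsUnit.mul_iff, IsUnit.mul_iff]
    refine ⟨⟨isUnit_of_invertible _, ?_⟩, ?_⟩
    · nth_rw 1 [Y_def, heq, ← (f Q).fromBlocks_toBlocks, con2.2]
      simpa [hf, fromBlocks_multiply, fromBlocks_add]
    · exact f_unit <| isUnit_nonsing_inv_iff.2 hU

theorem sp_generation {l : Type*} [DecidableEq l] [Fintype l]
    (P : Matrix (l ⊕ l) (l ⊕ l) ℚ → Prop)
    (hmul : ∀ A B, P A → P B → P (A * B)) (hJ : P (Matrix.J l ℚ))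
    (hU : ∀ S : Matrix l l ℚ, S.IsSymm → P (fromBlocks 1 S 0 1))
    (hT : ∀ (i j : l) (c : ℚ), i ≠ j →
      P (fromBlocks (transvection i j c) 0 0 (transvection j i (-c))))
    (M : Matrix (l ⊕ l) (l ⊕ l) ℚ) (hM : M ∈ symplecticGroup l ℚ) : P M := by
  have hLow : ∀ S : Matrix l l ℚ, S.IsSymm → P (fromBlocks 1 0 S 1) := by
    intro S hS
    have h := hmul _ _ (hmul _ _ (hmul _ _ (hmul _ _ hJ (hU (-S) hS.neg)) hJ) hJ) hJ
    convert h using 1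
    simp [Matrix.J, fromBlocks_multiply]
  have hSym : ∀ A : Matrix l l ℚ, A.IsSymm → IsUnit A.det → P (fromBlocks A 0 0 A⁻¹) := by
    intro A hA hdet
    have hAi : (A⁻¹).IsSymm := by
      rw [Matrix.IsSymm, transpose_nonsing_inv, hA.eq]
    have h := hmul _ _ (hmul _ _ (hmul _ _ (hU A hA) (hLow (-A⁻¹) hAi.neg)) (hU A hA)) hJ
    convert h using 1
    simp [Matrix.J, fromBlocks_multiply, mul_nonsing_inv _ hdet, nonsing_inv_mul _ hdet]
  have hDiag : ∀ A : Matrix l l ℚ, A.det ≠ 0 → P (fromBlocks A 0 0 (Aᵀ)⁻¹) := by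
    intro A hA
    refine diagonal_transvection_induction_of_det_ne_zero
      (fun A => P (fromBlocks A 0 0 (Aᵀ)⁻¹)) A hA ?_ ?_ ?_
    · intro D hD
      have := hSym (diagonal D) (isSymm_diagonal D) (isUnit_iff_ne_zero.2 hD)
      simpa using this
    · rintro ⟨i, j, hij, c⟩
      have h := hT i j c hij
      have e : ((transvection i j c)ᵀ)⁻¹ = transvection j i (-c) := by
        refine inv_eq_right_inv ?_
        have : (transvection i j c)ᵀ = transvection j i c := by
          simp [transvection, transpose_add]
        rw [this, transvection_mul_transvection_same _ _ hij.symm]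
        simp
      simp only [TransvectionStruct.toMatrix]
      rw [e]
      exact h
    · intro A B _ _ h1 h2
      have h := hmul _ _ h1 h2
      convert h using 1
      simp [fromBlocks_multiply, Matrix.mul_inv_rev]
  have hInv : ∀ A B C D : Matrix l l ℚ, fromBlocks A B C D ∈ symplecticGroup l ℚ →
      IsUnit A.det → P (fromBlocks A B C D) := by
    intro A B C D h hA
    have h1 := SymplecticGroup.fromBlocks_mem_iff.1 h
    have h2 := SymplecticGroup.transpose_mem h
    rw [fromBlocks_transpose] at h2
    have h3 := SymplecticGroup.fromBlocks_mem_iff.1 h2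
    simp only [transpose_transpose] at h3
    have hAt : IsUnit (Aᵀ).det := by rwa [det_transpose]
    have hY : (C * A⁻¹).IsSymm := by
      rw [Matrix.IsSymm, transpose_mul, transpose_nonsing_inv]
      calc (Aᵀ)⁻¹ * Cᵀ = (Aᵀ)⁻¹ * (Cᵀ * A) * A⁻¹ := by
            rw [Matrix.mul_assoc, Matrix.mul_assoc, mul_nonsing_inv _ hA, Matrix.mul_one]
        _ = C * A⁻¹ := by
            rw [← h1.1, ← Matrix.mul_assoc, nonsing_inv_mul _ hAt, Matrix.one_mul]
    have hZ : (A⁻¹ * B).IsSymm := by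
      rw [Matrix.IsSymm, transpose_mul, transpose_nonsing_inv]
      calc Bᵀ * (Aᵀ)⁻¹ = A⁻¹ * (A * Bᵀ) * (Aᵀ)⁻¹ := by
            rw [← Matrix.mul_assoc, nonsing_inv_mul _ hA, Matrix.one_mul]
        _ = A⁻¹ * B := by
            rw [h3.1, Matrix.mul_assoc, Matrix.mul_assoc, mul_nonsing_inv _ hAt, Matrix.mul_one]
    have hE : D = C * A⁻¹ * B + (Aᵀ)⁻¹ := by
      have : (Aᵀ)⁻¹ * (Aᵀ * D - Cᵀ * B) = (Aᵀ)⁻¹ := by rw [h1.2.2, Matrix.mul_one]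
      have e : (Aᵀ)⁻¹ * Cᵀ = C * A⁻¹ := by
        have := hY.eq
        rwa [transpose_mul, transpose_nonsing_inv] at this
      rw [Matrix.mul_sub, ← Matrix.mul_assoc, nonsing_inv_mul _ hAt, Matrix.one_mul,
        ← Matrix.mul_assoc, e] at this
      rw [← this]; abel
    have hh := hmul _ _ (hmul _ _ (hLow _ hY) (hDiag A hA.ne_zero)) (hU _ hZ)
    convert hh using 1
    have e1 : A * (A⁻¹ * B) = B := by
      rw [← Matrix.mul_assoc, mul_nonsing_inv _ hA, Matrix.one_mul]
    have e2 : C * A⁻¹ * A = C := by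
      rw [Matrix.mul_assoc, nonsing_inv_mul _ hA, Matrix.mul_one]
    have e3 : C * (A⁻¹ * B) + (Aᵀ)⁻¹ = D := by rw [hE, Matrix.mul_assoc]
    simp [fromBlocks_multiply, e1, e2, e3]
  obtain ⟨A, B, C, D, rfl⟩ : ∃ A B C D, M = fromBlocks A B C D :=
    ⟨_, _, _, _, M.fromBlocks_toBlocks.symm⟩
  have hUnit : IsUnit (fromBlocks A B C D) :=
    (isUnit_iff_isUnit_det _).2 (SymplecticGroup.symplectic_det hM)
  have hker (x : l → ℚ) (hx1 : A • x = 0) (hx2 : C • x = 0) : x = 0 := by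
    rw [smul_eq_mulVec] at hx1 hx2
    have hv0 : fromBlocks A B C D *ᵥ (Sum.elim x 0) = fromBlocks A B C D *ᵥ (Sum.elim 0 0) := by
      simp [fromBlocks_mulVec, hx1, hx2]
    exact (Sum.elim_eq_iff.1 (mulVec_injective_iff_isUnit.2 hUnit hv0)).1
  obtain ⟨X, hX, hXu⟩ := exists_symm_aux hker (SymplecticGroup.fromBlocks_mem_iff.1 hM).1
  have hmem : fromBlocks 1 X 0 1 * fromBlocks A B C D ∈ symplecticGroup l ℚ := by
    refine (symplecticGroup l ℚ).mul_mem ?_ hM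
    simp [SymplecticGroup.mem_iff, fromBlocks_transpose, hX.eq, Matrix.J, fromBlocks_multiply]
  have e : fromBlocks 1 X 0 1 * fromBlocks A B C D
      = fromBlocks (A + X * C) (B + X * D) C D := by
    simp [fromBlocks_multiply]
  rw [e] at hmem
  have h := hmul _ _ (hU (-X) hX.neg) (hInv _ _ _ _ hmem ((isUnit_iff_isUnit_det _).1 hXu))
  convert h using 1
  simp [fromBlocks_multiply]

theorem line_invariant (g d : ℕ) (ρ : Sp g →* GL (Fin d) ℚ)
    (hρ : IsRationalRep g d ρ)
    (L : AddSubgroup (Fin d → ℚ))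
    (hL : ∀ γ : Sp g, IsIntegralSp γ →
      ∀ x ∈ L, ((ρ γ : Matrix (Fin d) (Fin d) ℚ)).mulVec x ∈ L)
    (N0 N1 : Matrix (Fin g ⊕ Fin g) (Fin g ⊕ Fin g) ℚ)
    (hN : ∀ t : ℚ, N0 + t • N1 ∈ symplecticGroup (Fin g) ℚ)
    (k : ℕ) (hk : k ≠ 0)
    (hintegral : ∀ n : ℕ, IsIntegralSp (⟨N0 + ((k * n : ℕ) : ℚ) • N1, hN _⟩ : Sp g))
    (t : ℚ) (x : Fin d → ℚ) (hx : x ∈ L) :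
    ((ρ ⟨N0 + t • N1, hN t⟩ : Matrix (Fin d) (Fin d) ℚ)).mulVec x
      ∈ Submodule.span ℚ (L : Set (Fin d → ℚ)) := by
  obtain ⟨P, hP⟩ := hρ
  rw [← Subspace.forall_mem_dualAnnihilator_apply_eq_zero_iff]
  intro f hf
  rw [Submodule.mem_dualAnnihilator] at hf
  let q : Polynomial ℚ := ∑ i, Polynomial.C (f (Pi.single i 1)) * ∑ j,
    MvPolynomial.aeval (fun p : (Fin g ⊕ Fin g) × (Fin g ⊕ Fin g) =>
      (Polynomial.C (N0 p.1 p.2) + Polynomial.X * Polynomial.C (N1 p.1 p.2))) (P i j)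
      * Polynomial.C (x j)
  have hq : ∀ t : ℚ, q.eval t
      = f (((ρ ⟨N0 + t • N1, hN t⟩ : Matrix (Fin d) (Fin d) ℚ)).mulVec x) := by
    intro t
    rw [LinearMap.pi_apply_eq_sum_univ f]
    simp only [q, Polynomial.eval_finsetSum, Polynomial.eval_mul, Polynomial.eval_C]
    refine Finset.sum_congr rfl fun i _ => ?_
    rw [smul_eq_mul, mul_comm]
    congr 1
    · simp only [mulVec, dotProduct]
      refine Finset.sum_congr rfl fun j _ => ?_
      rw [hP]
      congr 1
      rw [← Polynomial.coe_evalRingHom, MvPolynomial.aeval_def, MvPolynomial.hom_eval₂,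
        ← MvPolynomial.eval₂_id]
      rw [MvPolynomial.eval₂_eq', MvPolynomial.eval₂_eq']
      simp [mul_comm t]
    · congr 1
      ext j
      simp [Pi.single_apply, eq_comm]
  have hq0 : q = 0 := by
    refine Polynomial.eq_zero_of_infinite_isRoot q ?_
    refine Set.Infinite.mono (s := Set.range fun n : ℕ => ((k * n : ℕ) : ℚ)) ?_ ?_
    · rintro _ ⟨n, rfl⟩
      show q.eval _ = 0
      rw [hq]
      exact hf _ (Submodule.subset_span (hL _ (hintegral n) x hx))
    · refine Set.infinite_range_of_injective fun a b hab => ?_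
      have : k * a = k * b := by exact_mod_cast hab
      exact Nat.eq_of_mul_eq_mul_left (Nat.pos_of_ne_zero hk) this
  rw [← hq, hq0, Polynomial.eval_zero]

theorem exists_common_den {m : Type*} [Fintype m] (S : Matrix m m ℚ) :
    ∃ k : ℕ, k ≠ 0 ∧ ∀ i j, ∃ z : ℤ, (k : ℚ) * S i j = z := by
  classical
  refine ⟨∏ p : m × m, (S p.1 p.2).den, Finset.prod_ne_zero_iff.2 fun p _ => (S _ _).den_nz, ?_⟩
  intro i j
  obtain ⟨c, hc⟩ : (S i j).den ∣ ∏ p : m × m, (S p.1 p.2).den :=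
    Finset.dvd_prod_of_mem (fun p : m × m => (S p.1 p.2).den) (Finset.mem_univ (i, j))
  refine ⟨c * (S i j).num, ?_⟩
  rw [hc]
  push_cast
  rw [← Rat.mul_den_eq_num (S i j)]
  ring

theorem statement7 (g d : ℕ) (ρ : Sp g →* GL (Fin d) ℚ)
    (hρ : IsRationalRep g d ρ)
    (L : AddSubgroup (Fin d → ℚ))
    (hL : ∀ γ : Sp g, IsIntegralSp γ →
      ∀ x ∈ L, ((ρ γ : Matrix (Fin d) (Fin d) ℚ)).mulVec x ∈ L) :
    ∀ M : Sp g, ∀ x ∈ Submodule.span ℚ (L : Set (Fin d → ℚ)),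
      ((ρ M : Matrix (Fin d) (Fin d) ℚ)).mulVec x ∈ Submodule.span ℚ (L : Set (Fin d → ℚ)) := by
    classical
  have lift : ∀ M : Sp g, (∀ x ∈ L, ((ρ M : Matrix (Fin d) (Fin d) ℚ)).mulVec x
      ∈ Submodule.span ℚ (L : Set (Fin d → ℚ))) →
      ∀ x ∈ Submodule.span ℚ (L : Set (Fin d → ℚ)),
      ((ρ M : Matrix (Fin d) (Fin d) ℚ)).mulVec x
        ∈ Submodule.span ℚ (L : Set (Fin d → ℚ)) := by
    intro M h
    have : Submodule.span ℚ (L : Set (Fin d → ℚ)) ≤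
        (Submodule.span ℚ (L : Set (Fin d → ℚ))).comap
          (Matrix.mulVecLin (ρ M : Matrix (Fin d) (Fin d) ℚ)) :=
      Submodule.span_le.2 fun x hx => h x hx
    exact fun x hx => this hx
  have key : ∀ M ∈ symplecticGroup (Fin g) ℚ, ∃ h : M ∈ symplecticGroup (Fin g) ℚ,
      ∀ x ∈ Submodule.span ℚ (L : Set (Fin d → ℚ)),
      ((ρ ⟨M, h⟩ : Matrix (Fin d) (Fin d) ℚ)).mulVec x
        ∈ Submodule.span ℚ (L : Set (Fin d → ℚ)) := by
    intro M hM
    refine sp_generation (fun M => ∃ h : M ∈ symplecticGroup (Fin g) ℚ,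
      ∀ x ∈ Submodule.span ℚ (L : Set (Fin d → ℚ)),
      ((ρ ⟨M, h⟩ : Matrix (Fin d) (Fin d) ℚ)).mulVec x
        ∈ Submodule.span ℚ (L : Set (Fin d → ℚ))) ?_ ?_ ?_ ?_ M hM
    · rintro A B ⟨hA, hA'⟩ ⟨hB, hB'⟩
      refine ⟨Submonoid.mul_mem _ hA hB, fun x hx => ?_⟩
      have e : (⟨A * B, Submonoid.mul_mem _ hA hB⟩ : Sp g) = ⟨A, hA⟩ * ⟨B, hB⟩ := rfl
      rw [e, map_mul, Units.val_mul, ← mulVec_mulVec]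
      exact hA' _ (hB' _ hx)
    · refine ⟨SymplecticGroup.J_mem _ _, lift _ fun x hx => Submodule.subset_span (hL _ ?_ x hx)⟩
      rintro (i | i) (j | j)
      · exact ⟨0, by simp [Matrix.J]⟩
      · exact ⟨-(if i = j then 1 else 0), by simp [Matrix.J, Matrix.one_apply]⟩
      · exact ⟨if i = j then 1 else 0, by simp [Matrix.J, Matrix.one_apply]⟩
      · exact ⟨0, by simp [Matrix.J]⟩
    · intro S hS
      obtain ⟨k, hk, hkS⟩ := exists_common_den S
      have hN : ∀ t : ℚ, (1 : Matrix (Fin g ⊕ Fin g) (Fin g ⊕ Fin g) ℚ)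
          + t • fromBlocks 0 S 0 0 ∈ symplecticGroup (Fin g) ℚ := by
        intro t
        rw [← fromBlocks_one, fromBlocks_smul, fromBlocks_add]
        simp [SymplecticGroup.mem_iff, fromBlocks_transpose, hS.eq, Matrix.J, fromBlocks_multiply]
      have e : fromBlocks 1 S 0 1 = (1 : Matrix (Fin g ⊕ Fin g) (Fin g ⊕ Fin g) ℚ)
          + (1 : ℚ) • fromBlocks 0 S 0 0 := by
        rw [← fromBlocks_one, fromBlocks_smul, fromBlocks_add]
        simp
      rw [e]
      refine ⟨hN 1, lift _ fun x hx => line_invariant g d ρ hρ L hL _ _ hN k hk ?_ 1 x hx⟩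
      intro n
      rintro (i | i) (j | j)
      · exact ⟨if i = j then 1 else 0, by simp [Matrix.one_apply]⟩
      · obtain ⟨z, hz⟩ := hkS i j
        refine ⟨n * z, ?_⟩
        push_cast
        rw [← hz]
        simp
        ring
      · exact ⟨0, by simp⟩
      · exact ⟨if i = j then 1 else 0, by simp [Matrix.one_apply]⟩
    · intro i j c hij
      have eq : ∀ t : ℚ, (1 : Matrix (Fin g ⊕ Fin g) (Fin g ⊕ Fin g) ℚ)
          + t • fromBlocks (Matrix.single i j 1) 0 0 (- Matrix.single j i 1)
          = fromBlocks (transvection i j t) 0 0 (transvection j i (-t)) := by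
        intro t
        rw [← fromBlocks_one, fromBlocks_smul, fromBlocks_add]
        simp only [transvection, ← Matrix.single_neg, Matrix.smul_single]
        simp
      have hN : ∀ t : ℚ, (1 : Matrix (Fin g ⊕ Fin g) (Fin g ⊕ Fin g) ℚ)
          + t • fromBlocks (Matrix.single i j 1) 0 0 (- Matrix.single j i 1)
          ∈ symplecticGroup (Fin g) ℚ := by
        intro t
        rw [eq, SymplecticGroup.fromBlocks_mem_iff]
        have : (transvection i j t)ᵀ = transvection j i t := by
          simp [transvection, transpose_add]
        refine ⟨by simp, by simp, ?_⟩
        rw [this, transvection_mul_transvection_same _ _ hij.symm]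
        simp
      simp only [← eq]
      refine ⟨hN c, lift _ fun x hx => line_invariant g d ρ hρ L hL _ _ hN 1 one_ne_zero ?_ c x hx⟩
      intro n
      rintro (a | a) (b | b)
      · exact ⟨(if a = b then 1 else 0) + n * (if i = a ∧ j = b then 1 else 0), by
          simp [Matrix.one_apply, Matrix.single_apply]⟩
      · exact ⟨0, by simp⟩
      · exact ⟨0, by simp⟩
      · exact ⟨(if a = b then 1 else 0) - n * (if j = a ∧ i = b then 1 else 0), by
          simp [Matrix.one_apply, Matrix.single_apply, sub_eq_add_neg]⟩
  intro M
  exact (key M.1 M.2).2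
end

section
/- Let ρ be a rational representation of Sp(2g,ℚ) on ℚᵈ, let L ⊆ ℚᵈ be a lattice (a finitely generated additive subgroup whose ℚ-linear span is all of ℚᵈ) with ρ(γ)(L) ⊆ L for every γ ∈ Sp(2g,ℤ), and let f: L → ℤ be an additive homomorphism such that f(ρ(γ)x) = f(x) for all γ ∈ Sp(2g,ℤ) and x ∈ L. If F: ℚᵈ → ℚ is a ℚ-linear map with F(x) = f(x) for all x ∈ L, then F(ρ(M)v) = F(v) for every M ∈ Sp(2g,ℚ) and every v ∈ ℚᵈ. -/
/-!
STATEMENT 9: Let `ρ` be a rational representation of `Sp(2g,ℚ)` on `ℚᵈ`, let `L ⊆ ℚᵈ` be a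
lattice (a finitely generated additive subgroup whose ℚ-linear span is all of `ℚᵈ`) with
`ρ(γ)(L) ⊆ L` for every `γ ∈ Sp(2g,ℤ)`, and let `f : L → ℤ` be an additive homomorphism
with `f(ρ(γ)x) = f(x)` for all `γ ∈ Sp(2g,ℤ)`, `x ∈ L`.  If `F : ℚᵈ → ℚ` is a ℚ-linear map
with `F = f` on `L`, then `F(ρ(M)v) = F(v)` for all `M ∈ Sp(2g,ℚ)`, `v ∈ ℚᵈ`.
-/

open Matrix

section gen
open SymplecticGroup

theorem u_mem {g : ℕ} {X : Matrix (Fin g) (Fin g) ℚ} (hX : Xᵀ = X) :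
    fromBlocks 1 X 0 1 ∈ Matrix.symplecticGroup (Fin g) ℚ := by
  rw [fromBlocks_mem_iff]; simp [hX]

theorem l_mem {g : ℕ} {X : Matrix (Fin g) (Fin g) ℚ} (hX : Xᵀ = X) :
    fromBlocks 1 0 X 1 ∈ Matrix.symplecticGroup (Fin g) ℚ := by
  rw [fromBlocks_mem_iff]; simp [hX]

theorem gen_aux {g : ℕ} (P : Matrix (Fin g ⊕ Fin g) (Fin g ⊕ Fin g) ℚ → Prop)
    (hmul : ∀ A B, P A → P B → P (A * B))
    (hJ : P (J (Fin g) ℚ))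
    (hB : ∀ B : Matrix (Fin g ⊕ Fin g) (Fin g ⊕ Fin g) ℚ,
      (∀ t : ℚ, 1 + t • B ∈ Matrix.symplecticGroup (Fin g) ℚ) → P (1 + B))
    (M : Matrix (Fin g ⊕ Fin g) (Fin g ⊕ Fin g) ℚ)
    (hM : M ∈ Matrix.symplecticGroup (Fin g) ℚ) : P M := by
  have hu : ∀ X : Matrix (Fin g) (Fin g) ℚ, Xᵀ = X → P (fromBlocks 1 X 0 1) := by
    intro X hX
    have := hB (fromBlocks 0 X 0 0) (fun t => by
      rw [← fromBlocks_one, fromBlocks_smul, fromBlocks_add]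
      simpa using u_mem (X := t • X) (by simp [hX]))
    rw [← fromBlocks_one, fromBlocks_add] at this
    simpa using this
  have hl : ∀ X : Matrix (Fin g) (Fin g) ℚ, Xᵀ = X → P (fromBlocks 1 0 X 1) := by
    intro X hX
    have := hB (fromBlocks 0 0 X 0) (fun t => by
      rw [← fromBlocks_one, fromBlocks_smul, fromBlocks_add]
      simpa using l_mem (X := t • X) (by simp [hX]))
    rw [← fromBlocks_one, fromBlocks_add] at this
    simpa using this
  have hd : ∀ A : Matrix (Fin g) (Fin g) ℚ, A.det ≠ 0 → P (fromBlocks A 0 0 (A⁻¹)ᵀ) := by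
    intro A hA
    refine diagonal_transvection_induction_of_det_ne_zero
      (fun A => P (fromBlocks A 0 0 (A⁻¹)ᵀ)) A hA ?_ ?_ ?_
    · intro D hD
      have hs : ((diagonal D)⁻¹)ᵀ = (diagonal D)⁻¹ := by
        rw [transpose_nonsing_inv, diagonal_transpose]
      have hdu : IsUnit (diagonal D).det := isUnit_iff_ne_zero.2 hD
      have h1 := hmul _ _ (hmul _ _ (hmul _ _ (hu (diagonal D) (diagonal_transpose D))
        (hl (-(diagonal D)⁻¹) (by rw [transpose_neg, hs]))) (hu (diagonal D) (diagonal_transpose D))) hJ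
      convert h1 using 1
      rw [hs]
      simp only [J, fromBlocks_multiply, Matrix.mul_neg, Matrix.neg_mul, mul_nonsing_inv _ hdu,
        nonsing_inv_mul _ hdu]
      simp [nonsing_inv_mul _ hdu]
    · intro t
      have hinv : (t.toMatrix)⁻¹ = transvection t.i t.j (-t.c) := by
        apply inv_eq_left_inv
        have := t.inv_mul
        simpa [TransvectionStruct.inv, TransvectionStruct.toMatrix] using this
      have := hB (fromBlocks (single t.i t.j t.c) 0 0 (-(single t.j t.i t.c))) (fun s => by
        rw [← fromBlocks_one, fromBlocks_smul, fromBlocks_add, fromBlocks_mem_iff]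
        have := t.hij
        simp [Matrix.add_mul, Matrix.mul_add, single_mul_single_of_ne, this, this.symm])
      rw [← fromBlocks_one, fromBlocks_add] at this
      rw [hinv]
      have e1 : (transvection t.i t.j (-t.c))ᵀ = 1 + -(single t.j t.i t.c) := by
        rw [transvection, transpose_add, transpose_one, transpose_single, single_neg]
      rw [e1]
      simp only [add_zero] at this
      exact this
    · intro A B hA hB' pA pB
      have := hmul _ _ pA pB
      rw [fromBlocks_multiply] at this
      simpa [Matrix.mul_inv_rev] using this
  obtain ⟨A, B, C, D, rfl⟩ : ∃ A B C D, M = fromBlocks A B C D :=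
    ⟨_, _, _, _, (fromBlocks_toBlocks M).symm⟩
  have hunit : IsUnit (fromBlocks A B C D) :=
    (isUnit_iff_isUnit_det _).2 (symplectic_det hM)
  obtain ⟨X, hX, hXu⟩ := exists_symm_aux (A := A) (C := C) (fun x hx1 hx2 => by
    rw [smul_eq_mulVec] at hx1 hx2
    have hv0 : fromBlocks A B C D *ᵥ (Sum.elim x 0) = fromBlocks A B C D *ᵥ (Sum.elim 0 0) := by
      simp [fromBlocks_mulVec, hx1, hx2]
    exact (Sum.elim_eq_iff.1 (mulVec_injective_iff_isUnit.2 hunit hv0)).1)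
    (fromBlocks_mem_iff.1 hM).1
  have key : ∀ A B C D : Matrix (Fin g) (Fin g) ℚ, IsUnit A →
      fromBlocks A B C D ∈ Matrix.symplecticGroup (Fin g) ℚ → P (fromBlocks A B C D) := by
    intro A B C D hA hM
    have hAu := (isUnit_iff_isUnit_det _).1 hA
    have hAu' : IsUnit (Aᵀ).det := by rwa [det_transpose]
    obtain ⟨e1, e2, e3⟩ := fromBlocks_mem_iff.1 hM
    have hY : (C * A⁻¹)ᵀ = C * A⁻¹ := by
      rw [transpose_mul, transpose_nonsing_inv]
      calc Aᵀ⁻¹ * Cᵀ = Aᵀ⁻¹ * (Cᵀ * A) * A⁻¹ := by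
            rw [Matrix.mul_assoc, mul_nonsing_inv_cancel_right _ _ hAu]
        _ = C * A⁻¹ := by rw [← e1, nonsing_inv_mul_cancel_left _ _ hAu']
    have hD : D = Aᵀ⁻¹ + C * A⁻¹ * B := by
      have h : Aᵀ⁻¹ * (Aᵀ * D - Cᵀ * B) = Aᵀ⁻¹ := by rw [e3, Matrix.mul_one]
      rw [Matrix.mul_sub, nonsing_inv_mul_cancel_left _ _ hAu', ← Matrix.mul_assoc] at h
      rw [← hY, transpose_mul, transpose_nonsing_inv]
      exact sub_eq_iff_eq_add.1 h
    have hfac : fromBlocks A B C D = fromBlocks 1 0 (C * A⁻¹) 1 *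
        (fromBlocks A 0 0 (A⁻¹)ᵀ * fromBlocks 1 (A⁻¹ * B) 0 1) := by
      simp only [fromBlocks_multiply]
      simp only [Matrix.mul_one, Matrix.one_mul, Matrix.mul_zero, Matrix.zero_mul, add_zero,
        zero_add, mul_nonsing_inv_cancel_left _ _ hAu, nonsing_inv_mul_cancel_right _ _ hAu]
      rw [transpose_nonsing_inv, hD, add_comm]
    have hZ : (A⁻¹ * B)ᵀ = A⁻¹ * B := by
      have e4 : Bᵀ * Aᵀ⁻¹ = A⁻¹ * B := by
        rw [hD] at e2
        simp only [Matrix.mul_add, Matrix.add_mul, transpose_add, transpose_mul,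
          transpose_nonsing_inv, transpose_transpose] at e2
        have h2 := hY
        rw [transpose_mul, transpose_nonsing_inv] at h2
        rw [h2, Matrix.mul_assoc Bᵀ] at e2
        exact add_right_cancel e2
      rw [transpose_mul, transpose_nonsing_inv, e4]
    rw [hfac]
    exact hmul _ _ (hl _ hY) (hmul _ _ (hd A hAu.ne_zero) (hu _ hZ))
  have e : fromBlocks A B C D =
      fromBlocks 1 (-X) 0 1 * (fromBlocks 1 X 0 1 * fromBlocks A B C D) := by
    simp [fromBlocks_multiply]
  have h2 := mul_mem (u_mem hX.eq) hM
  rw [e]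
  refine hmul _ _ (hu _ (by rw [transpose_neg, hX.eq])) ?_
  rw [fromBlocks_multiply] at h2 ⊢
  exact key _ _ _ _ (by simpa using hXu) h2

end gen

theorem poly_const (p : Polynomial ℚ) (c : ℚ) (N : ℕ) (hN : N ≠ 0)
    (h : ∀ k : ℕ, p.eval ((k * N : ℕ) : ℚ) = c) (t : ℚ) : p.eval t = c := by
  have : p = Polynomial.C c := by
    refine Polynomial.eq_of_infinite_eval_eq _ _ ?_
    refine Set.Infinite.mono (s := Set.range (fun k : ℕ => ((k * N : ℕ) : ℚ))) ?_ ?_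
    · rintro _ ⟨k, rfl⟩
      simpa using h k
    · apply Set.infinite_range_of_injective
      intro a b hab
      have hab2 : ((a * N : ℕ) : ℚ) = ((b * N : ℕ) : ℚ) := hab
      have : a * N = b * N := by exact_mod_cast hab2
      exact Nat.eq_of_mul_eq_mul_right (Nat.pos_of_ne_zero hN) this
  rw [this]; simp

theorem clear_den {ι : Type*} [Fintype ι] (B : ι → ι → ℚ) :
    ∃ N : ℕ, N ≠ 0 ∧ ∀ i j, ∃ k : ℤ, (N : ℚ) * B i j = k := by
  classical
  refine ⟨∏ p : ι × ι, (B p.1 p.2).den, Finset.prod_ne_zero_iff.2 fun p _ => (B p.1 p.2).den_nz, ?_⟩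
  intro i j
  obtain ⟨m, hm⟩ := Finset.dvd_prod_of_mem (fun p : ι × ι => (B p.1 p.2).den)
    (Finset.mem_univ (i, j))
  refine ⟨m * (B i j).num, ?_⟩
  rw [hm]
  push_cast
  have := Rat.den_mul_eq_num (B i j)
  linear_combination (m : ℚ) * this

theorem statement9 (g d : ℕ) (ρ : Sp g →* GL (Fin d) ℚ)
    (hρ : IsRationalRep g d ρ)
    (L : AddSubgroup (Fin d → ℚ))
    (hfg : L.FG)
    (hspan : Submodule.span ℚ (L : Set (Fin d → ℚ)) = ⊤)
    (hL : ∀ γ : Sp g, IsIntegralSp γ →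
      ∀ x ∈ L, ((ρ γ : Matrix (Fin d) (Fin d) ℚ)).mulVec x ∈ L)
    (f : L →+ ℤ)
    (hf : ∀ γ : Sp g, IsIntegralSp γ → ∀ (x : L)
      (h : ((ρ γ : Matrix (Fin d) (Fin d) ℚ)).mulVec (x : Fin d → ℚ) ∈ L),
      f ⟨((ρ γ : Matrix (Fin d) (Fin d) ℚ)).mulVec (x : Fin d → ℚ), h⟩ = f x)
    (F : (Fin d → ℚ) →ₗ[ℚ] ℚ)
    (hF : ∀ x : L, F (x : Fin d → ℚ) = (f x : ℚ)) :
    ∀ (M : Sp g) (v : Fin d → ℚ),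
      F (((ρ M : Matrix (Fin d) (Fin d) ℚ)).mulVec v) = F v := by
  have hint : ∀ γ : Sp g, IsIntegralSp γ → ∀ v,
      F (((ρ γ : Matrix (Fin d) (Fin d) ℚ)).mulVec v) = F v := by
    intro γ hγ v
    have : F ∘ₗ (Matrix.mulVecLin (ρ γ : Matrix (Fin d) (Fin d) ℚ)) = F := by
      refine LinearMap.ext_on hspan ?_
      intro x hx
      have h1 := hL γ hγ x hx
      have h2 := hf γ hγ ⟨x, hx⟩ h1
      have h3 := hF ⟨_, h1⟩
      rw [h2, ← hF] at h3
      simpa using h3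
    simpa using LinearMap.congr_fun this v
  obtain ⟨P, hP⟩ := hρ
  intro M
  suffices hs : ∃ h : M.1 ∈ Matrix.symplecticGroup (Fin g) ℚ, ∀ v,
      F (((ρ ⟨M.1, h⟩ : Matrix (Fin d) (Fin d) ℚ)).mulVec v) = F v from hs.2
  refine gen_aux (fun M => ∃ h : M ∈ Matrix.symplecticGroup (Fin g) ℚ, ∀ v,
      F (((ρ ⟨M, h⟩ : Matrix (Fin d) (Fin d) ℚ)).mulVec v) = F v) ?_ ?_ ?_ M.1 M.2
  · rintro A B ⟨hA, hA'⟩ ⟨hB, hB'⟩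
    refine ⟨mul_mem hA hB, fun v => ?_⟩
    have : (⟨A * B, mul_mem hA hB⟩ : Sp g) = ⟨A, hA⟩ * ⟨B, hB⟩ := rfl
    rw [this, map_mul, Units.val_mul, ← Matrix.mulVec_mulVec, hA', hB']
  · refine ⟨SymplecticGroup.J_mem _ _, hint _ ?_⟩
    rintro (i | i) (j | j)
    · exact ⟨0, by simp [J]⟩
    · exact ⟨if i = j then -1 else 0, by simp [J, Matrix.one_apply]; split_ifs <;> simp⟩
    · exact ⟨if i = j then 1 else 0, by simp [J, Matrix.one_apply]⟩
    · exact ⟨0, by simp [J]⟩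
  · intro B hB
    have hB1 := hB 1
    rw [one_smul] at hB1
    refine ⟨hB1, fun v => ?_⟩
    obtain ⟨N, hN, hNB⟩ := clear_den B
    let q : Fin d → Fin d → Polynomial ℚ := fun i j =>
      MvPolynomial.eval₂ Polynomial.C
        (fun p => Polynomial.C ((1 : Matrix (Fin g ⊕ Fin g) (Fin g ⊕ Fin g) ℚ) p.1 p.2)
          + Polynomial.X * Polynomial.C (B p.1 p.2)) (P i j)
    have hq : ∀ (t : ℚ) i j, (q i j).eval t =
        (ρ ⟨1 + t • B, hB t⟩ : Matrix (Fin d) (Fin d) ℚ) i j := by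
      intro t i j
      rw [hP]
      simp only [q]
      rw [← Polynomial.coe_evalRingHom, MvPolynomial.hom_eval₂, MvPolynomial.eval]
      congr 1
      · ext; simp
      · ext p
        simp
        ring
    let r : Polynomial ℚ := ∑ i, Polynomial.C (F (Pi.single i 1)) *
      ∑ j, q i j * Polynomial.C (v j)
    have hr : ∀ t : ℚ, r.eval t =
        F (((ρ ⟨1 + t • B, hB t⟩ : Matrix (Fin d) (Fin d) ℚ)).mulVec v) := by
      intro t
      rw [LinearMap.pi_apply_eq_sum_univ F]
      simp only [r, Polynomial.eval_finset_sum, Polynomial.eval_mul, Polynomial.eval_C, hq,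
        smul_eq_mul, Matrix.mulVec, dotProduct]
      refine Finset.sum_congr rfl fun i _ => ?_
      rw [mul_comm]
      congr 2
      ext j
      simp [Pi.single_apply, eq_comm]
    have := poly_const r (F v) N hN (fun k => by
      rw [hr]
      refine hint _ ?_ v
      intro i j
      obtain ⟨m, hm⟩ := hNB i j
      refine ⟨(if i = j then 1 else 0) + k * m, ?_⟩
      simp only [Matrix.add_apply, Matrix.smul_apply, Matrix.one_apply, smul_eq_mul]
      push_cast
      rw [mul_assoc, hm]) 1
    rw [hr] at this
    simpa using this
end

section
/- Assume V is finite-dimensional and fix n ≥ 1. For every f ∈ B_{≤n} and every σ ∈ X, the n-th derivative dⁿ_σf: Vⁿ → 𝔽₂ does not depend on σ and is an alternating 𝔽₂-multilinear map; it vanishes if f ∈ B_{≤n−1}; and the induced map from the quotient group B_{≤n}/B_{≤n−1} to the group of alternating n-multilinear maps Vⁿ → 𝔽₂ is a group isomorphism. -/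
/-!
STATEMENT 12: Let `V` be a finite-dimensional `𝔽₂`-vector space, `X` a nonempty affine space
over `V`, and `n ≥ 1`.  For `f ∈ B_{≤n}`, the `n`-th derivative `dⁿ_σf : Vⁿ → 𝔽₂` does not
depend on `σ` and is an alternating multilinear map; it vanishes if `f ∈ B_{≤n−1}`; and the
induced map `B_{≤n}/B_{≤n−1} → {alternating n-multilinear maps Vⁿ → 𝔽₂}` is a group
isomorphism.
-/

open Finset

variable (V : Type) [AddCommGroup V] [Module (ZMod 2) V]
variable (X : Type) [AddTorsor V X]

/-- `f : X → 𝔽₂` is affine if there is a linear `ℓ : V → 𝔽₂` with `f(σ+v) = f(σ) + ℓ(v)`. -/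
def IsAffineFn (f : X → ZMod 2) : Prop :=
  ∃ ℓ : V →ₗ[ZMod 2] ZMod 2, ∀ (σ : X) (v : V), f (v +ᵥ σ) = f σ + ℓ v

/-- `B_{≤n}`: the additive group of functions `X → 𝔽₂` generated by products of at most `n`
affine functions. -/
def Ble (n : ℕ) : AddSubgroup (X → ZMod 2) :=
  AddSubgroup.closure
    {f : X → ZMod 2 | ∃ s : Multiset (X → ZMod 2),
      Multiset.card s ≤ n ∧ (∀ g ∈ s, IsAffineFn V X g) ∧ f = s.prod}

/-- The `n`-th derivative of `f` at `σ`: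
`dⁿ_σf(y₁,…,yₙ) = Σ_{P ⊆ {1,…,n}} f(σ + Σ_{p∈P} y_p)`. -/
def derivN (n : ℕ) (f : X → ZMod 2) (σ : X) (y : Fin n → V) : ZMod 2 :=
  ∑ P : Finset (Fin n), f ((∑ p ∈ P, y p) +ᵥ σ)

section Helpers

set_option linter.unusedSectionVars false

variable {V X}
variable {ι : Type} [DecidableEq ι]

/-- Derivative over an arbitrary finite index set. -/
def gder (T : Finset ι) (y : ι → V) (f : X → ZMod 2) (σ : X) : ZMod 2 :=
  ∑ P ∈ T.powerset, f ((∑ p ∈ P, y p) +ᵥ σ)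

/-- First difference. -/
def dif (v : V) (f : X → ZMod 2) : X → ZMod 2 := fun σ => f σ + f (v +ᵥ σ)

theorem gder_insert {a : ι} {T : Finset ι} (ha : a ∉ T) (y : ι → V) (f : X → ZMod 2) (σ : X) :
    gder (insert a T) y f σ = gder T y (dif (y a) f) σ := by
  unfold gder dif
  rw [Finset.sum_powerset_insert ha, ← Finset.sum_add_distrib]
  refine Finset.sum_congr rfl fun P hP => ?_
  have : a ∉ P := fun h => ha (Finset.mem_powerset.1 hP h)
  rw [Finset.sum_insert this, add_vadd]

theorem gder_add (T : Finset ι) (y : ι → V) (f g : X → ZMod 2) (σ : X) :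
    gder T y (f + g) σ = gder T y f σ + gder T y g σ := by
  simp [gder, Finset.sum_add_distrib]

theorem gder_dif (T : Finset ι) (y : ι → V) (f : X → ZMod 2) (v : V) (σ : X) :
    gder T y (dif v f) σ = gder T y f σ + gder T y f (v +ᵥ σ) := by
  unfold gder dif
  rw [← Finset.sum_add_distrib]
  refine Finset.sum_congr rfl fun P hP => ?_
  rw [vadd_comm]

theorem gder_congr {T : Finset ι} {y y' : ι → V} (h : ∀ i ∈ T, y i = y' i)
    (f : X → ZMod 2) (σ : X) : gder T y f σ = gder T y' f σ := by
  unfold gder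
  refine Finset.sum_congr rfl fun P hP => ?_
  rw [Finset.sum_congr rfl fun i hi => h i (Finset.mem_powerset.1 hP hi)]

theorem ble_mono {m n : ℕ} (h : m ≤ n) : Ble V X m ≤ Ble V X n := by
  refine AddSubgroup.closure_mono ?_
  rintro f ⟨s, hs, h1, h2⟩
  exact ⟨s, hs.trans h, h1, h2⟩

theorem prod_mem_ble {n : ℕ} (s : Multiset (X → ZMod 2)) (hs : Multiset.card s ≤ n)
    (h : ∀ g ∈ s, IsAffineFn V X g) : s.prod ∈ Ble V X n :=
  AddSubgroup.subset_closure ⟨s, hs, h, rfl⟩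

theorem affine_mul_mem {n : ℕ} {a f : X → ZMod 2} (ha : IsAffineFn V X a)
    (hf : f ∈ Ble V X n) : a * f ∈ Ble V X (n + 1) := by
  induction hf using AddSubgroup.closure_induction with
  | mem f hf =>
    obtain ⟨s, hs, h, rfl⟩ := hf
    rw [← Multiset.prod_cons]
    refine prod_mem_ble _ (by simpa using hs) ?_
    intro g hg
    rcases Multiset.mem_cons.1 hg with rfl | hg
    · exact ha
    · exact h g hg
  | zero => rw [mul_zero]; exact zero_mem _
  | add f g _ _ h1 h2 => rw [mul_add]; exact add_mem h1 h2
  | neg f _ h => rw [mul_neg]; exact neg_mem h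

theorem shift_mem {n : ℕ} {f : X → ZMod 2} (v : V)
    (hf : f ∈ Ble V X n) : (fun σ => f (v +ᵥ σ)) ∈ Ble V X n := by
  induction hf using AddSubgroup.closure_induction with
  | mem f hf =>
    obtain ⟨s, hs, h, rfl⟩ := hf
    have : (fun σ => s.prod (v +ᵥ σ)) = (s.map fun g : X → ZMod 2 => fun σ => g (v +ᵥ σ)).prod := by
      clear hs h
      induction s using Multiset.induction with
      | empty => rfl
      | cons a s ih =>
        rw [Multiset.map_cons, Multiset.prod_cons, Multiset.prod_cons, ← ih]
        rfl
    rw [this]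
    refine prod_mem_ble _ (by simpa using hs) ?_
    intro g hg
    obtain ⟨g, hg', rfl⟩ := Multiset.mem_map.1 hg
    obtain ⟨l, hl⟩ := h g hg'
    refine ⟨l, fun σ w => ?_⟩
    simp only [hl]
    ring
  | zero => exact zero_mem _
  | add f g _ _ h1 h2 => exact add_mem h1 h2
  | neg f _ h => exact neg_mem h

theorem smul_mem_ble {n : ℕ} {f : X → ZMod 2} (c : ZMod 2) (hf : f ∈ Ble V X n) :
    c • f ∈ Ble V X n := by
  have : c = 0 ∨ c = 1 := by revert c; decide
  rcases this with rfl | rfl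
  · rw [zero_smul]; exact zero_mem _
  · rwa [one_smul]

theorem dif_prod_mem (v : V) (s : Multiset (X → ZMod 2)) : ∀ n : ℕ,
    Multiset.card s ≤ n + 1 → (∀ g ∈ s, IsAffineFn V X g) → dif v s.prod ∈ Ble V X n := by
  induction s using Multiset.induction with
  | empty =>
    intro n _ _
    have : dif v (Multiset.prod (0 : Multiset (X → ZMod 2))) = 0 := by
      funext σ; simp [dif, CharTwo.add_self_eq_zero]
    rw [this]; exact zero_mem _
  | cons a t ih =>
    intro n hn h
    have ha : IsAffineFn V X a := h a (Multiset.mem_cons_self _ _)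
    have ht : ∀ g ∈ t, IsAffineFn V X g := fun g hg => h g (Multiset.mem_cons_of_mem hg)
    have hc : Multiset.card t ≤ n := by simpa using hn
    obtain ⟨l, hl⟩ := id ha
    have key : dif v (a ::ₘ t).prod = a * dif v t.prod + l v • (fun σ => t.prod (v +ᵥ σ)) := by
      funext σ
      simp only [dif, Multiset.prod_cons, Pi.mul_apply, Pi.add_apply, Pi.smul_apply, hl,
        smul_eq_mul]
      ring
    rw [key]
    refine add_mem ?_ (smul_mem_ble _ (shift_mem v (prod_mem_ble t hc ht)))
    cases n with
    | zero =>
      have : t = 0 := by simpa using hc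
      subst this
      have : dif v (Multiset.prod (0 : Multiset (X → ZMod 2))) = 0 := by
        funext σ; simp [dif, CharTwo.add_self_eq_zero]
      rw [this, mul_zero]; exact zero_mem _
    | succ n => exact affine_mul_mem ha (ih n hc ht)

theorem dif_add (v : V) (f g : X → ZMod 2) : dif v (f + g) = dif v f + dif v g := by
  funext σ; simp only [dif, Pi.add_apply]; ring

theorem dif_mem {n : ℕ} {f : X → ZMod 2} (v : V) (hf : f ∈ Ble V X (n + 1)) :
    dif v f ∈ Ble V X n := by
  induction hf using AddSubgroup.closure_induction with
  | mem f hf =>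
    obtain ⟨s, hs, h, rfl⟩ := hf
    exact dif_prod_mem v s n hs h
  | zero =>
    have : dif v (0 : X → ZMod 2) = 0 := by funext σ; simp [dif]
    rw [this]; exact zero_mem _
  | add f g _ _ h1 h2 => rw [dif_add]; exact add_mem h1 h2
  | neg f _ h =>
    have : dif v (-f) = - dif v f := by funext σ; simp only [dif, Pi.neg_apply]; ring
    rw [this]; exact neg_mem h

theorem dif_zero_of_mem {f : X → ZMod 2} (v : V) (hf : f ∈ Ble V X 0) :
    dif v f = 0 := by
  induction hf using AddSubgroup.closure_induction with
  | mem f hf =>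
    obtain ⟨s, hs, h, rfl⟩ := hf
    have : s = 0 := by simpa using hs
    subst this
    funext σ; simp [dif, CharTwo.add_self_eq_zero]
  | zero => funext σ; simp [dif]
  | add f g _ _ h1 h2 => rw [dif_add, h1, h2, add_zero]
  | neg f _ h =>
    have : dif v (-f) = - dif v f := by funext σ; simp only [dif, Pi.neg_apply]; ring
    rw [this, h, neg_zero]

theorem gder_zero (T : Finset ι) (y : ι → V) (σ : X) : gder T y (0 : X → ZMod 2) σ = 0 := by
  simp [gder]

theorem gder_eq_zero (T : Finset ι) (y : ι → V) : ∀ (m : ℕ) (f : X → ZMod 2) (σ : X),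
    m < T.card → f ∈ Ble V X m → gder T y f σ = 0 := by
  induction T using Finset.induction with
  | empty => intro m f σ h; simp at h
  | insert a T ha ih =>
    intro m f σ h hf
    rw [gder_insert ha]
    rw [Finset.card_insert_of_notMem ha] at h
    cases m with
    | zero => rw [dif_zero_of_mem _ hf, gder_zero]
    | succ m => exact ih m _ σ (by omega) (dif_mem _ hf)

theorem gder_indep (T : Finset ι) (y : ι → V) (f : X → ZMod 2) (σ σ' : X)
    (hf : f ∈ Ble V X T.card) : gder T y f σ = gder T y f σ' := by
  have h : gder T y (dif (σ' -ᵥ σ) f) σ = 0 := by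
    cases hc : T.card with
    | zero => rw [hc] at hf; rw [dif_zero_of_mem _ hf, gder_zero]
    | succ m => rw [hc] at hf; exact gder_eq_zero T y m _ σ (by omega) (dif_mem _ hf)
  rw [gder_dif, vsub_vadd] at h
  exact CharTwo.add_eq_zero.1 h

theorem dif_add_vec (u v : V) (f : X → ZMod 2) :
    dif (u + v) f = dif u f + dif v f + dif u (dif v f) := by
  funext σ
  simp only [dif, Pi.add_apply, add_vadd, vadd_comm v u]
  have h2 : (2 : ZMod 2) = 0 := by decide
  linear_combination (-f σ - f (u +ᵥ σ) - f (v +ᵥ σ)) * h2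

theorem gder_insert_add {T : Finset ι} (y : ι → V) (u v : V)
    (f : X → ZMod 2) (σ : X) (hf : f ∈ Ble V X (T.card + 1)) :
    gder T y (dif (u + v) f) σ = gder T y (dif u f) σ + gder T y (dif v f) σ := by
  rw [dif_add_vec, gder_add, gder_add]
  have h : gder T y (dif u (dif v f)) σ = 0 := by
    have hd := dif_mem v hf
    cases hc : T.card with
    | zero => rw [hc] at hd; rw [dif_zero_of_mem _ hd, gder_zero]
    | succ m => rw [hc] at hd; exact gder_eq_zero T y m _ σ (by omega) (dif_mem _ hd)
  rw [h, add_zero]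

theorem derivN_eq_gder (n : ℕ) (f : X → ZMod 2) (σ : X) (y : Fin n → V) :
    derivN V X n f σ y = gder Finset.univ y f σ := by
  simp [derivN, gder]

theorem derivN_eq_erase (n : ℕ) (f : X → ZMod 2) (σ : X) (y : Fin n → V) (i : Fin n) (v : V) :
    derivN V X n f σ (Function.update y i v) = gder (Finset.univ.erase i) y (dif v f) σ := by
  rw [derivN_eq_gder]
  conv_lhs => rw [← Finset.insert_erase (Finset.mem_univ i)]
  rw [gder_insert (Finset.notMem_erase _ _), Function.update_self]
  refine gder_congr (fun j hj => ?_) _ _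
  rw [Function.update_of_ne (Finset.ne_of_mem_erase hj)]

theorem derivN_update_add (n : ℕ) (f : X → ZMod 2) (hf : f ∈ Ble V X n) (σ : X)
    (y : Fin n → V) (i : Fin n) (u v : V) :
    derivN V X n f σ (Function.update y i (u + v)) =
      derivN V X n f σ (Function.update y i u) + derivN V X n f σ (Function.update y i v) := by
  simp only [derivN_eq_erase]
  refine gder_insert_add y u v f σ ?_
  rw [Finset.card_erase_add_one (Finset.mem_univ i)]
  simpa using hf

theorem sum_symmDiff_two (y : ι → V) (P Q : Finset ι) :
    ∑ p ∈ symmDiff P Q, y p = ∑ p ∈ P, y p + ∑ p ∈ Q, y p := by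
  have h1 := Finset.sum_inter_add_sum_sdiff P Q y
  have h2 := Finset.sum_inter_add_sum_sdiff Q P y
  rw [Finset.inter_comm] at h2
  have h3 : symmDiff P Q = (P \ Q) ∪ (Q \ P) := rfl
  rw [h3, Finset.sum_union (by
    rw [Finset.disjoint_left]; intro a; simp; tauto), ← h1, ← h2]
  have := ZModModule.add_self (∑ p ∈ P ∩ Q, y p)
  rw [add_add_add_comm, this, zero_add]

theorem derivN_alt (n : ℕ) (f : X → ZMod 2) (σ : X)
    (y : Fin n → V) (i j : Fin n) (hy : y i = y j) (hij : i ≠ j) :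
    derivN V X n f σ y = 0 := by
  unfold derivN
  refine Finset.sum_involution (fun P _ => symmDiff P {i, j}) ?_ ?_ (by simp) ?_
  · intro P _
    rw [sum_symmDiff_two, Finset.sum_pair hij, hy, ZModModule.add_self, add_zero]
    exact CharTwo.add_self_eq_zero _
  · intro P _ _ h
    rw [symmDiff_eq_left] at h
    simp at h
  · intro P _
    simp

/-- The alternating map attached to `f`. -/
noncomputable def altOf (n : ℕ) (σ : X) (f : Ble V X n) : V [⋀^Fin n]→ₗ[ZMod 2] ZMod 2 where
  toFun y := derivN V X n f σ y
  map_update_add' := by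
    intro inst y i u v
    obtain rfl : inst = instDecidableEqFin n := Subsingleton.elim _ _
    exact derivN_update_add n f f.2 σ y i u v
  map_update_smul' := by
    intro inst y i c v
    obtain rfl : inst = instDecidableEqFin n := Subsingleton.elim _ _
    have h0 : derivN V X n f σ (Function.update y i 0) = 0 := by
      have := derivN_update_add n f f.2 σ y i 0 0
      rw [add_zero] at this
      simpa using this
    have : c = 0 ∨ c = 1 := by revert c; decide
    rcases this with rfl | rfl
    · rw [zero_smul, zero_smul, h0]
    · rw [one_smul, one_smul]
  map_eq_zero_of_eq' := by
    intro y i j hy hij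
    exact derivN_alt n f σ y i j hy hij

/-- The hom version. -/
noncomputable def altHom (n : ℕ) (σ : X) : Ble V X n →+ (V [⋀^Fin n]→ₗ[ZMod 2] ZMod 2) :=
  AddMonoidHom.mk' (altOf n σ) (by
    intro f g
    ext y
    change derivN V X n _ σ y = derivN V X n _ σ y + derivN V X n _ σ y
    simp only [derivN_eq_gder]
    exact gder_add _ _ _ _ _)

theorem altHom_apply (n : ℕ) (σ : X) (f : Ble V X n) (y : Fin n → V) :
    altHom n σ f y = derivN V X n f σ y := rfl

section Coord
variable {d : ℕ}

/-- Monomials. -/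
noncomputable def mono (b : Module.Basis (Fin d) (ZMod 2) V) (σ₀ : X)
    (S : Finset (Fin d)) : X → ZMod 2 :=
  ∏ i ∈ S, fun σ => b.repr (σ -ᵥ σ₀) i

theorem mono_mem (b : Module.Basis (Fin d) (ZMod 2) V) (σ₀ : X)
    (S : Finset (Fin d)) {n : ℕ} (h : S.card ≤ n) : mono b σ₀ S ∈ Ble V X n := by
  refine prod_mem_ble _ (by simpa using h) ?_
  intro g hg
  obtain ⟨i, _, rfl⟩ := Multiset.mem_map.1 hg
  refine ⟨b.coord i, fun σ v => ?_⟩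
  simp [vadd_vsub_assoc, add_comm]

theorem mono_apply (b : Module.Basis (Fin d) (ZMod 2) V) (σ₀ : X)
    (S P : Finset (Fin d)) :
    mono b σ₀ S ((∑ p ∈ P, b p) +ᵥ σ₀) = if S ⊆ P then 1 else 0 := by
  have h : ∀ i, b.repr (∑ p ∈ P, b p) i = if i ∈ P then 1 else 0 := by
    intro i
    simp [Finsupp.single_apply]
  simp only [mono, Finset.prod_apply, vadd_vsub, h]
  rw [Finset.prod_ite_zero]
  simp [Finset.subset_iff]

theorem exists_coord (b : Module.Basis (Fin d) (ZMod 2) V) (σ₀ : X)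
    (σ : X) : ∃ P : Finset (Fin d), σ = (∑ p ∈ P, b p) +ᵥ σ₀ := by
  refine ⟨Finset.univ.filter fun i => b.repr (σ -ᵥ σ₀) i = 1, ?_⟩
  rw [eq_vadd_iff_vsub_eq]
  conv_lhs => rw [← b.sum_repr (σ -ᵥ σ₀)]
  rw [Finset.sum_filter]
  refine Finset.sum_congr rfl fun i _ => ?_
  generalize b.repr (σ -ᵥ σ₀) i = c
  have : c = 0 ∨ c = 1 := by revert c; decide
  rcases this with rfl | rfl <;> simp

theorem moebius (b : Module.Basis (Fin d) (ZMod 2) V) (σ₀ : X)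
    (f : X → ZMod 2) :
    f = ∑ S : Finset (Fin d), gder S b f σ₀ • mono b σ₀ S := by
  funext σ
  obtain ⟨T, rfl⟩ := exists_coord b σ₀ σ
  simp only [Finset.sum_apply, Pi.smul_apply, mono_apply, smul_eq_mul, mul_ite, mul_one, mul_zero]
  rw [← Finset.sum_filter]
  unfold gder
  rw [Finset.sum_comm' (t' := T.powerset) (s' := fun P => Finset.Icc P T)]
  · simp only [Finset.sum_const]
    rw [Finset.sum_eq_single T]
    · simp
    · intro P hP hne
      have hP' := Finset.mem_powerset.1 hP
      rw [Finset.card_Icc_finset hP']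
      have : P.card < T.card := Finset.card_lt_card (lt_of_le_of_ne hP' hne)
      obtain ⟨k, hk⟩ : ∃ k, T.card - P.card = k + 1 := ⟨T.card - P.card - 1, by omega⟩
      rw [hk, nsmul_eq_mul, pow_succ]
      have h2 : (2 : ZMod 2) = 0 := by decide
      push_cast
      rw [h2]; ring
    · simp
  · intro S P
    simp only [Finset.mem_filter, Finset.mem_univ, true_and, Finset.mem_powerset, Finset.mem_Icc]
    exact ⟨fun h => ⟨⟨h.2, h.1⟩, h.2.trans h.1⟩, fun h => ⟨h.1.2, h.1.1⟩⟩

theorem gder_eq_derivN (b : Module.Basis (Fin d) (ZMod 2) V)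
    (n : ℕ) (S : Finset (Fin d)) (hS : S.card = n) (f : X → ZMod 2) (σ : X) :
    gder S b f σ = derivN V X n f σ (fun i => b (S.orderEmbOfFin hS i)) := by
  unfold gder derivN
  symm
  refine Finset.sum_bij (fun P _ => P.map (S.orderEmbOfFin hS).toEmbedding) ?_ ?_ ?_ ?_
  · intro P _
    rw [Finset.mem_powerset]
    intro x hx
    obtain ⟨i, _, rfl⟩ := Finset.mem_map.1 hx
    exact Finset.orderEmbOfFin_mem S hS i
  · intro P _ Q _ h
    exact Finset.map_injective _ h
  · intro Q hQ
    rw [Finset.mem_powerset] at hQ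
    refine ⟨Finset.univ.filter fun i => S.orderEmbOfFin hS i ∈ Q, Finset.mem_univ _, ?_⟩
    ext x
    simp only [Finset.mem_map, Finset.mem_filter, Finset.mem_univ, true_and]
    constructor
    · rintro ⟨i, hi, rfl⟩; exact hi
    · intro hx
      have : x ∈ Set.range (S.orderEmbOfFin hS) := by
        rw [Finset.range_orderEmbOfFin]; exact hQ hx
      obtain ⟨i, rfl⟩ := this
      exact ⟨i, hx, rfl⟩
  · intro P _
    simp

theorem mem_of_derivN_zero (b : Module.Basis (Fin d) (ZMod 2) V) (σ₀ : X)
    (n : ℕ) (f : X → ZMod 2) (hf : f ∈ Ble V X n)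
    (h : ∀ y, derivN V X n f σ₀ y = 0) : f ∈ Ble V X (n - 1) := by
  rw [moebius b σ₀ f]
  refine sum_mem fun S _ => ?_
  rcases lt_trichotomy S.card n with hS | hS | hS
  · exact smul_mem_ble _ (mono_mem b σ₀ S (by omega))
  · rw [gder_eq_derivN b n S hS, h, zero_smul]; exact zero_mem _
  · rw [gder_eq_zero S b n f σ₀ hS hf, zero_smul]; exact zero_mem _

theorem alt_perm {n : ℕ} (A : V [⋀^Fin n]→ₗ[ZMod 2] ZMod 2) (y : Fin n → V)
    (e : Equiv.Perm (Fin n)) : A (y ∘ e) = A y := by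
  rw [AlternatingMap.map_perm]
  rcases Int.units_eq_one_or (Equiv.Perm.sign e) with h | h <;> rw [h]
  · simp
  · rw [Units.neg_smul, one_smul, CharTwo.neg_eq]

theorem exists_alt (b : Module.Basis (Fin d) (ZMod 2) V) (σ₀ : X)
    {n : ℕ} (A : V [⋀^Fin n]→ₗ[ZMod 2] ZMod 2) :
    ∃ f : Ble V X n, altHom n σ₀ f = A := by
  let c : Finset (Fin d) → ZMod 2 := fun S =>
    if hS : S.card = n then A (fun i => b (S.orderEmbOfFin hS i)) else 0
  have hc : ∀ S, S.card ≠ n → c S = 0 := fun S hS => dif_neg hS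
  let f : X → ZMod 2 := ∑ S : Finset (Fin d), c S • mono b σ₀ S
  have hf : f ∈ Ble V X n := by
    refine sum_mem fun S _ => ?_
    by_cases hS : S.card = n
    · exact smul_mem_ble _ (mono_mem b σ₀ S hS.le)
    · rw [hc S hS, zero_smul]; exact zero_mem _
  have hfT : ∀ T : Finset (Fin d), T.card ≤ n → f ((∑ p ∈ T, b p) +ᵥ σ₀) = c T := by
    intro T hT
    simp only [f, Finset.sum_apply, Pi.smul_apply, mono_apply, smul_eq_mul]
    rw [Finset.sum_eq_single T]
    · simp
    · intro S _ hne
      by_cases hS : S.card = n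
      · rw [if_neg, mul_zero]
        intro hST
        exact hne (Finset.eq_of_subset_of_card_le hST (by omega))
      · rw [hc S hS, zero_mul]
    · simp
  refine ⟨⟨f, hf⟩, ?_⟩
  refine Module.Basis.ext_alternating b ?_
  intro t ht
  rw [altHom_apply]
  have key : ∀ P : Finset (Fin n), f ((∑ p ∈ P, b (t p)) +ᵥ σ₀) = c (P.map ⟨t, ht⟩) := by
    intro P
    rw [← hfT _ (by rw [Finset.card_map]; simpa using P.card_le_univ)]
    simp
  unfold derivN
  simp only [key]
  rw [Finset.sum_eq_single Finset.univ]
  · have hS : (Finset.univ.map ⟨t, ht⟩ : Finset (Fin d)).card = n := by simp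
    simp only [c]
    rw [dif_pos hS]
    set S : Finset (Fin d) := Finset.univ.map ⟨t, ht⟩ with hSdef
    have hmem : ∀ i, ∃ j, S.orderEmbOfFin hS j = t i := by
      intro i
      have : t i ∈ Set.range (S.orderEmbOfFin hS) := by
        rw [Finset.range_orderEmbOfFin]; simp [hSdef]
      exact this
    choose e he using hmem
    have hinj : Function.Injective e := by
      intro i j hij
      apply ht
      rw [← he, ← he, hij]
    have hbij : Function.Bijective e := Finite.injective_iff_bijective.1 hinj
    rw [← alt_perm A _ (Equiv.ofBijective e hbij)]
    congr 1
    funext i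
    exact congrArg b (he i)
  · intro P _ hP
    apply hc
    rw [Finset.card_map]
    intro h
    exact hP (Finset.eq_univ_of_card P (by simpa using h))
  · simp

end Coord

end Helpers

theorem statement12 [FiniteDimensional (ZMod 2) V] (n : ℕ) (hn : 1 ≤ n) :
    (∀ f ∈ Ble V X n, ∀ σ σ' : X, derivN V X n f σ = derivN V X n f σ') ∧
    (∀ f ∈ Ble V X n, ∀ σ : X,
      ∃ A : V [⋀^Fin n]→ₗ[ZMod 2] ZMod 2, ∀ y : Fin n → V, derivN V X n f σ y = A y) ∧
    (∀ f ∈ Ble V X (n - 1), ∀ (σ : X) (y : Fin n → V), derivN V X n f σ y = 0) ∧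
    ∃ Φ : (Ble V X n ⧸ (Ble V X (n - 1)).addSubgroupOf (Ble V X n)) ≃+
        (V [⋀^Fin n]→ₗ[ZMod 2] ZMod 2),
      ∀ (f : Ble V X n) (σ : X) (y : Fin n → V),
        Φ (QuotientAddGroup.mk f) y = derivN V X n (f : X → ZMod 2) σ y := by
  obtain ⟨σ₀⟩ : Nonempty X := inferInstance
  have b := Module.finBasis (ZMod 2) V
  have h1 : ∀ f ∈ Ble V X n, ∀ σ σ' : X, derivN V X n f σ = derivN V X n f σ' := by
    intro f hf σ σ'
    funext y
    rw [derivN_eq_gder, derivN_eq_gder]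
    exact gder_indep _ y f σ σ' (by simpa using hf)
  have h3 : ∀ f ∈ Ble V X (n - 1), ∀ (σ : X) (y : Fin n → V), derivN V X n f σ y = 0 := by
    intro f hf σ y
    rw [derivN_eq_gder]
    exact gder_eq_zero _ y (n - 1) f σ (by simp; omega) hf
  refine ⟨h1, ?_, h3, ?_⟩
  · intro f hf σ
    exact ⟨altHom n σ ⟨f, hf⟩, fun y => rfl⟩
  · have hker : (Ble V X (n - 1)).addSubgroupOf (Ble V X n) = (altHom n σ₀).ker := by
      ext f
      rw [AddSubgroup.mem_addSubgroupOf, AddMonoidHom.mem_ker]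
      constructor
      · intro hf
        ext y
        exact h3 f hf σ₀ y
      · intro hf
        refine mem_of_derivN_zero b σ₀ n f f.2 fun y => ?_
        rw [← altHom_apply, hf]
        rfl
    refine ⟨(QuotientAddGroup.quotientAddEquivOfEq hker).trans
      (QuotientAddGroup.quotientKerEquivOfSurjective (altHom n σ₀)
        (fun A => exists_alt b σ₀ A)), ?_⟩
    intro f σ y
    rw [h1 f f.2 σ σ₀]
    rfl
end

section
/- For every function f: X → 𝔽₂ and every n ≥ 0: f belongs to B_{≤n} if and only if d^{n+1}_σ f = 0 for some σ ∈ X, if and only if d^{n+1}_σ f = 0 for every σ ∈ X. Moreover, if f ∈ B_{≤n} with n ≥ 1, then dⁿ_σf does not depend on the choice of σ, is 𝔽₂-multilinear in (y₁,…,yₙ), and satisfies dⁿ_σf(y₁,…,yₙ) = 0 whenever yᵢ = yⱼ for some i ≠ j. -/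
/-!
STATEMENT 13: Let `V` be a finite-dimensional `𝔽₂`-vector space and `X` a nonempty affine
space over `V`.  For every `f : X → 𝔽₂` and `n ≥ 0`: `f ∈ B_{≤n}` iff `d^{n+1}_σ f = 0` for
some `σ`, iff `d^{n+1}_σ f = 0` for every `σ`.  Moreover, if `f ∈ B_{≤n}` with `n ≥ 1`, then
`dⁿ_σf` does not depend on `σ`, is `𝔽₂`-multilinear, and vanishes whenever two arguments
coincide.
-/

open Finset

variable (V : Type) [AddCommGroup V] [Module (ZMod 2) V]
variable (X : Type) [AddTorsor V X]

namespace St13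

variable {V X}

/-- The difference operator. -/
def D (v : V) (f : X → ZMod 2) : X → ZMod 2 := fun x => f x + f (v +ᵥ x)

lemma two_zero : (2 : ZMod 2) = 0 := rfl

lemma add_self2 (a : ZMod 2) : a + a = 0 := CharTwo.add_self_eq_zero a

lemma derivN_zero (f : X → ZMod 2) (σ : X) (y : Fin 0 → V) : derivN V X 0 f σ y = f σ := by
  unfold derivN
  rw [← Finset.powerset_univ, Finset.univ_eq_empty, Finset.powerset_empty, Finset.sum_singleton,
    Finset.sum_empty, zero_vadd]

lemma derivN_add (n : ℕ) (f g : X → ZMod 2) (σ : X) (y : Fin n → V) :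
    derivN V X n (f + g) σ y = derivN V X n f σ y + derivN V X n g σ y := by
  simp [derivN, Finset.sum_add_distrib]

lemma derivN_D (n : ℕ) (f : X → ZMod 2) (σ : X) (v : V) (y : Fin n → V) :
    derivN V X n (D v f) σ y = derivN V X n f σ y + derivN V X n f (v +ᵥ σ) y := by
  simp only [derivN, D, Finset.sum_add_distrib]
  congr 1
  refine Finset.sum_congr rfl fun P _ => ?_
  rw [vadd_vadd, vadd_vadd, add_comm]

lemma derivN_succ (n : ℕ) (f : X → ZMod 2) (σ : X) (y : Fin (n + 1) → V) (i : Fin (n + 1)) :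
    derivN V X (n + 1) f σ y = derivN V X n (D (y i) f) σ (i.removeNth y) := by
  have hinj : Function.Injective (Finset.map i.succAboveEmb) := Finset.map_injective _
  have hp : (Finset.univ.map i.succAboveEmb).powerset
      = (Finset.univ : Finset (Finset (Fin n))).map ⟨Finset.map i.succAboveEmb, hinj⟩ := by
    ext S
    simp only [Finset.mem_powerset, Finset.mem_map, Finset.mem_univ, true_and,
      Function.Embedding.coeFn_mk, Finset.subset_map_iff, Finset.subset_univ]
    exact ⟨fun ⟨u, hu⟩ => ⟨u, hu.symm⟩, fun ⟨u, hu⟩ => ⟨u, hu.symm⟩⟩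
  have hni : i ∉ Finset.univ.map i.succAboveEmb := by simp [Fin.succAbove_ne]
  unfold derivN
  rw [← Finset.powerset_univ, Fin.univ_succAbove n i, Finset.cons_eq_insert,
    Finset.sum_powerset_insert hni, hp, Finset.sum_map, Finset.sum_map, ← Finset.sum_add_distrib]
  refine Finset.sum_congr rfl fun P _ => ?_
  have h2 : i ∉ P.map i.succAboveEmb := by simp [Fin.succAbove_ne]
  simp only [Function.Embedding.coeFn_mk, D]
  rw [Finset.sum_insert h2, Finset.sum_map, add_vadd]
  rfl

lemma derivN_cons (n : ℕ) (f : X → ZMod 2) (σ : X) (v : V) (y : Fin n → V) :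
    derivN V X (n + 1) f σ (Fin.cons v y) = derivN V X n (D v f) σ y := by
  rw [derivN_succ n f σ _ 0]
  simp

lemma D_add_left (u v : V) (f : X → ZMod 2) :
    D (u + v) f = D u f + D v f + D u (D v f) := by
  ext x
  simp only [D, Pi.add_apply, vadd_vadd]
  rw [add_comm v u]
  linear_combination (- f x - f (u +ᵥ x) - f (v +ᵥ x)) * two_zero

lemma derivN_add_left (n : ℕ) (f : X → ZMod 2) (σ : X) (u v : V) (y : Fin n → V) :
    derivN V X n (D (u + v) f) σ y = derivN V X n (D u f) σ y + derivN V X n (D v f) σ y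
      + derivN V X n (D u (D v f)) σ y := by
  rw [D_add_left, derivN_add, derivN_add]

lemma all_of_some (n : ℕ) (f : X → ZMod 2) (σ : X)
    (h : ∀ y : Fin (n + 1) → V, derivN V X (n + 1) f σ y = 0) (τ : X)
    (y : Fin (n + 1) → V) : derivN V X (n + 1) f τ y = 0 := by
  have key : ∀ v : V, derivN V X (n + 1) (D v f) σ y = 0 := by
    intro v
    have h' : ∀ (w : V) (z : Fin n → V), derivN V X n (D w f) σ z = 0 := by
      intro w z
      rw [← derivN_cons]; exact h _
    rw [derivN_succ n _ σ y 0]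
    have := derivN_add_left n f σ (y 0) v (Fin.removeNth 0 y)
    rw [h', h', h'] at this
    simpa using this.symm
  have h3 := derivN_D (n + 1) f σ (τ -ᵥ σ) y
  rw [key, h, vsub_vadd, zero_add] at h3
  exact h3.symm

/-! ### Forward direction -/

lemma affine_translate {g : X → ZMod 2} (hg : IsAffineFn V X g) (v : V) :
    IsAffineFn V X (fun x => g (v +ᵥ x)) := by
  obtain ⟨l, hl⟩ := hg
  refine ⟨l, fun σ w => ?_⟩
  simp only [hl]; ring

lemma affine_const (c : ZMod 2) : IsAffineFn V X (fun _ => c) := ⟨0, by simp⟩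

lemma Ble_mono {m n : ℕ} (h : m ≤ n) : Ble V X m ≤ Ble V X n := by
  apply AddSubgroup.closure_mono
  rintro f ⟨s, hs, h2⟩
  exact ⟨s, hs.trans h, h2⟩

lemma prod_mem {n : ℕ} (s : Multiset (X → ZMod 2)) (hs : Multiset.card s ≤ n)
    (h : ∀ g ∈ s, IsAffineFn V X g) : s.prod ∈ Ble V X n :=
  AddSubgroup.subset_closure ⟨s, hs, h, rfl⟩

lemma const_mul_mem {n : ℕ} (c : ZMod 2) {f : X → ZMod 2} (hf : f ∈ Ble V X n) :
    (fun x => c * f x) ∈ Ble V X n := by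
  have hc : c = 0 ∨ c = 1 := by revert c; decide
  rcases hc with rfl | rfl
  · simp only [zero_mul]; exact (Ble V X n).zero_mem
  · simpa using hf

lemma affine_mul_mem {n : ℕ} {a : X → ZMod 2} (ha : IsAffineFn V X a) {f : X → ZMod 2}
    (hf : f ∈ Ble V X n) : a * f ∈ Ble V X (n + 1) := by
  induction hf using AddSubgroup.closure_induction with
  | mem f hf =>
    obtain ⟨s, hs, h, rfl⟩ := hf
    rw [← Multiset.prod_cons]
    refine prod_mem _ (by simpa using hs) ?_
    intro g hg
    rcases Multiset.mem_cons.1 hg with rfl | hg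
    · exact ha
    · exact h g hg
  | zero => simpa using (Ble V X (n + 1)).zero_mem
  | add f g _ _ h1 h2 => rw [mul_add]; exact add_mem h1 h2
  | neg f _ h => rw [mul_neg]; exact neg_mem h

lemma translate_prod (s : Multiset (X → ZMod 2)) (v : V) :
    (fun x => s.prod (v +ᵥ x)) = (s.map (fun g : X → ZMod 2 => fun x => g (v +ᵥ x))).prod := by
  induction s using Multiset.induction with
  | empty => rfl
  | cons a s ih => simp only [Multiset.map_cons, Multiset.prod_cons, ← ih]; rfl

lemma D_prod_mem (v : V) (s : Multiset (X → ZMod 2)) (h : ∀ g ∈ s, IsAffineFn V X g) :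
    ∀ n, Multiset.card s ≤ n + 1 → D v s.prod ∈ Ble V X n := by
  induction s using Multiset.induction with
  | empty =>
    intro n _
    convert (Ble V X n).zero_mem using 1
    ext x; simp [D, add_self2]
  | cons a t ih =>
    intro n hn
    have ha := h a (Multiset.mem_cons_self a t)
    have ht : ∀ g ∈ t, IsAffineFn V X g := fun g hg => h g (Multiset.mem_cons_of_mem hg)
    rw [Multiset.card_cons] at hn
    obtain ⟨l, hl⟩ := id ha
    have e : D v (a ::ₘ t).prod = (fun x => l v * (fun x => t.prod (v +ᵥ x)) x)
        + a * D v t.prod := by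
      ext x
      simp only [D, Multiset.prod_cons, Pi.mul_apply, Pi.add_apply, hl]
      ring
    rw [e]
    refine add_mem (const_mul_mem _ ?_) ?_
    · rw [translate_prod]
      refine prod_mem _ (by simp; omega) ?_
      intro g hg
      obtain ⟨g', hg', rfl⟩ := Multiset.mem_map.1 hg
      exact affine_translate (ht g' hg') v
    · rcases n with _ | n
      · have : t = 0 := Multiset.card_eq_zero.1 (by omega)
        subst this
        convert (Ble V X 0).zero_mem using 1
        ext x; simp [D, add_self2]
      · exact affine_mul_mem ha (ih ht n (by omega))

lemma D_mem {n : ℕ} (v : V) {f : X → ZMod 2} (hf : f ∈ Ble V X (n + 1)) :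
    D v f ∈ Ble V X n := by
  induction hf using AddSubgroup.closure_induction with
  | mem f hf =>
    obtain ⟨s, hs, h, rfl⟩ := hf
    exact D_prod_mem v s h n hs
  | zero =>
    convert (Ble V X n).zero_mem using 1
    ext x; simp [D]
  | add f g _ _ h1 h2 =>
    have : D v (f + g) = D v f + D v g := by ext x; simp only [D, Pi.add_apply]; ring
    rw [this]; exact add_mem h1 h2
  | neg f _ h =>
    have : D v (-f) = - D v f := by ext x; simp only [D, Pi.neg_apply]; ring
    rw [this]; exact neg_mem h

lemma D_zero {f : X → ZMod 2} (v : V) (hf : f ∈ Ble V X 0) : D v f = 0 := by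
  induction hf using AddSubgroup.closure_induction with
  | mem f hf =>
    obtain ⟨s, hs, h, rfl⟩ := hf
    have : s = 0 := Multiset.card_eq_zero.1 (by omega)
    subst this
    ext x; simp [D, add_self2]
  | zero => ext x; simp [D]
  | add f g _ _ h1 h2 =>
    have : D v (f + g) = D v f + D v g := by ext x; simp only [D, Pi.add_apply]; ring
    rw [this, h1, h2, add_zero]
  | neg f _ h =>
    have : D v (-f) = - D v f := by ext x; simp only [D, Pi.neg_apply]; ring
    rw [this, h, neg_zero]

lemma forward (n : ℕ) : ∀ (f : X → ZMod 2), f ∈ Ble V X n → ∀ (σ : X)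
    (y : Fin (n + 1) → V), derivN V X (n + 1) f σ y = 0 := by
  induction n with
  | zero =>
    intro f hf σ y
    rw [derivN_succ 0 f σ y 0, derivN_zero, D_zero _ hf]; rfl
  | succ n ih =>
    intro f hf σ y
    rw [derivN_succ (n + 1) f σ y 0]
    exact ih _ (D_mem _ hf) _ _

/-! ### Backward direction -/

lemma moebius {ι : Type*} [DecidableEq ι] (T : Finset ι) : ∀ g : Finset ι → ZMod 2,
    ∑ S ∈ T.powerset, ∑ P ∈ S.powerset, g P = g T := by
  induction T using Finset.induction_on with
  | empty => intro g; simp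
  | insert a T ha ih =>
    intro g
    rw [Finset.sum_powerset_insert ha, ih]
    have : ∀ S ∈ T.powerset, ∑ P ∈ (insert a S).powerset, g P
        = ∑ P ∈ S.powerset, g P + ∑ P ∈ S.powerset, g (insert a P) := by
      intro S hS
      exact Finset.sum_powerset_insert (fun h => ha (Finset.mem_powerset.1 hS h)) _
    rw [Finset.sum_congr rfl this, Finset.sum_add_distrib, ih, ih (fun P => g (insert a P)),
      ← add_assoc, add_self2, zero_add]

lemma coeff_zero {ι : Type*} [DecidableEq ι] (b : ι → V) (n : ℕ) : ∀ (f : X → ZMod 2),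
    (∀ (σ : X) (y : Fin n → V), derivN V X n f σ y = 0) → ∀ (σ : X) (S : Finset ι),
    n ≤ S.card → ∑ P ∈ S.powerset, f ((∑ i ∈ P, b i) +ᵥ σ) = 0 := by
  induction n with
  | zero =>
    intro f hf σ S _
    refine Finset.sum_eq_zero fun P _ => ?_
    rw [← derivN_zero f _ (fun _ => (0 : V))]; exact hf _ _
  | succ n ih =>
    intro f hf σ S hS
    obtain ⟨a, ha⟩ : S.Nonempty := Finset.card_pos.1 (by omega)
    have hna := Finset.notMem_erase a S
    rw [← Finset.insert_erase ha, Finset.sum_powerset_insert hna, ← Finset.sum_add_distrib]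
    rw [← ih (D (b a) f) (fun τ y => by rw [← derivN_cons]; exact hf _ _) σ (S.erase a)
      (by rw [Finset.card_erase_of_mem ha]; omega)]
    refine Finset.sum_congr rfl fun P hP => ?_
    rw [Finset.sum_insert (fun h => hna (Finset.mem_powerset.1 hP h)), add_vadd]
    rfl

lemma backward [FiniteDimensional (ZMod 2) V] (n : ℕ) (f : X → ZMod 2)
    (hf : ∀ (σ : X) (y : Fin (n + 1) → V), derivN V X (n + 1) f σ y = 0) : f ∈ Ble V X n := by
  classical
  obtain ⟨σ⟩ : Nonempty X := AddTorsor.nonempty (G := V)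
  let b := Module.finBasis (ZMod 2) V
  let x : Fin (Module.finrank (ZMod 2) V) → X → ZMod 2 := fun i p => b.repr (p -ᵥ σ) i
  have hx : ∀ i, IsAffineFn V X (x i) := by
    intro i
    refine ⟨b.coord i, fun τ v => ?_⟩
    simp only [x, vadd_vsub_assoc, map_add, Finsupp.add_apply, Module.Basis.coord_apply]
    ring
  let c : Finset (Fin (Module.finrank (ZMod 2) V)) → ZMod 2 :=
    fun S => ∑ P ∈ S.powerset, f ((∑ i ∈ P, b i) +ᵥ σ)
  have hfe : f = ∑ S : Finset (Fin (Module.finrank (ZMod 2) V)),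
      (fun p => c S * (S.val.map x).prod p) := by
    ext p
    let T := Finset.univ.filter (fun i => x i p = 1)
    have h01 : ∀ a : ZMod 2, a ≠ 1 → a = 0 := by decide
    have hp : p = (∑ i ∈ T, b i) +ᵥ σ := by
      rw [eq_vadd_iff_vsub_eq]
      rw [← b.sum_repr (p -ᵥ σ), Finset.sum_filter]
      refine Finset.sum_congr rfl fun i _ => ?_
      change x i p • b i = _
      split_ifs with h
      · rw [h, one_smul]
      · rw [h01 _ h, zero_smul]
    have hm := moebius T (fun P => f ((∑ i ∈ P, b i) +ᵥ σ))
    simp only [← hp] at hm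
    rw [← hm, Finset.sum_apply]
    rw [← Finset.sum_subset (Finset.subset_univ T.powerset)]
    · refine Finset.sum_congr rfl fun S hS => ?_
      have : (S.val.map x).prod p = 1 := by
        change (∏ i ∈ S, x i) p = 1
        rw [Finset.prod_apply]
        refine Finset.prod_eq_one fun i hi => ?_
        exact (Finset.mem_filter.1 (Finset.mem_powerset.1 hS hi)).2
      rw [this, mul_one]
    · intro S _ hS
      rw [Finset.mem_powerset, Finset.not_subset] at hS
      obtain ⟨i, hi, hiT⟩ := hS
      have : (S.val.map x).prod p = 0 := by
        change (∏ i ∈ S, x i) p = 0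
        rw [Finset.prod_apply]
        refine Finset.prod_eq_zero hi (h01 _ fun h => hiT ?_)
        exact Finset.mem_filter.2 ⟨Finset.mem_univ _, h⟩
      rw [this, mul_zero]
  rw [hfe]
  refine sum_mem fun S _ => ?_
  by_cases hS : n + 1 ≤ S.card
  · have : c S = 0 := coeff_zero b (n + 1) f hf σ S hS
    simp only [this, zero_mul]
    exact (Ble V X n).zero_mem
  · refine const_mul_mem _ (prod_mem _ (by rw [Multiset.card_map]; change S.card ≤ n; omega) ?_)
    intro g hg
    obtain ⟨i, _, rfl⟩ := Multiset.mem_map.1 hg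
    exact hx i

/-! ### The leading form -/

lemma D_D_self (v : V) (f : X → ZMod 2) : D v (D v f) = 0 := by
  ext x
  have hv : v + v = 0 := by
    rw [← two_smul (ZMod 2) v, show (2 : ZMod 2) = 0 from rfl, zero_smul]
  simp only [D, vadd_vadd, hv, zero_vadd, Pi.zero_apply]
  linear_combination (f x + f (v +ᵥ x)) * two_zero

lemma derivN_fn_zero (n : ℕ) (σ : X) (y : Fin n → V) : derivN V X n 0 σ y = 0 := by
  simp [derivN]

lemma update_eq (n : ℕ) (f : X → ZMod 2) (σ : X) (y : Fin (n + 1) → V) (i : Fin (n + 1)) (v : V) :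
    derivN V X (n + 1) f σ (Function.update y i v) = derivN V X n (D v f) σ (i.removeNth y) := by
  rw [derivN_succ n f σ _ i]; simp

lemma alt (n : ℕ) (f : X → ZMod 2) (σ : X) (y : Fin n → V) (i j : Fin n) (hij : i ≠ j)
    (h : y i = y j) : derivN V X n f σ y = 0 := by
  rcases n with _ | _ | n
  · exact i.elim0
  · exact absurd (Fin.ext (by omega)) hij
  · obtain ⟨k, rfl⟩ := Fin.exists_succAbove_eq hij.symm
    rw [derivN_succ (n + 1) f σ y i, derivN_succ n _ σ _ k]
    have : i.removeNth y k = y i := h.symm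
    rw [this, D_D_self, derivN_fn_zero]

end St13

theorem statement13 [FiniteDimensional (ZMod 2) V] :
    ∀ (f : X → ZMod 2) (n : ℕ),
      ((f ∈ Ble V X n ↔ ∃ σ : X, ∀ y : Fin (n + 1) → V, derivN V X (n + 1) f σ y = 0) ∧
       (f ∈ Ble V X n ↔ ∀ (σ : X) (y : Fin (n + 1) → V), derivN V X (n + 1) f σ y = 0)) ∧
      (f ∈ Ble V X n → 1 ≤ n →
        (∀ σ σ' : X, derivN V X n f σ = derivN V X n f σ') ∧
        (∀ σ : X, ∃ m : MultilinearMap (ZMod 2) (fun _ : Fin n => V) (ZMod 2),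
          ∀ y : Fin n → V, derivN V X n f σ y = m y) ∧
        (∀ (σ : X) (y : Fin n → V) (i j : Fin n), i ≠ j → y i = y j →
          derivN V X n f σ y = 0)) := by
  intro f n
  have back : (∃ σ : X, ∀ y : Fin (n + 1) → V, derivN V X (n + 1) f σ y = 0) → f ∈ Ble V X n :=
    fun ⟨σ, h⟩ => St13.backward n f (St13.all_of_some n f σ h)
  refine ⟨⟨⟨fun h => ?_, back⟩, ⟨fun h => St13.forward n f h, St13.backward n f⟩⟩, ?_⟩
  · obtain ⟨σ⟩ : Nonempty X := AddTorsor.nonempty (G := V)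
    exact ⟨σ, St13.forward n f h σ⟩
  intro hf hn
  have h0 := St13.forward n f hf
  refine ⟨?_, ?_, fun σ y i j hij h => St13.alt n f σ y i j hij h⟩
  · intro σ σ'
    ext y
    have h1 := St13.derivN_D n f σ (σ' -ᵥ σ) y
    rw [← St13.derivN_cons, h0, vsub_vadd] at h1
    exact CharTwo.add_eq_zero.1 h1.symm
  · intro σ
    obtain ⟨n, rfl⟩ : ∃ m, n = m + 1 := ⟨n - 1, by omega⟩
    have hadd : ∀ (m : Fin (n + 1) → V) (i : Fin (n + 1)) (x y : V),
        derivN V X (n + 1) f σ (Function.update m i (x + y))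
          = derivN V X (n + 1) f σ (Function.update m i x)
            + derivN V X (n + 1) f σ (Function.update m i y) := by
      intro m i x y
      rw [St13.update_eq, St13.update_eq, St13.update_eq, St13.derivN_add_left,
        ← St13.derivN_cons n (St13.D y f), ← St13.derivN_cons (n + 1) f, h0, add_zero]
    refine ⟨⟨derivN V X (n + 1) f σ, ?_, ?_⟩, fun y => rfl⟩
    · intro inst m i x y
      convert hadd m i x y
    · intro inst m i c x
      have hc : c = 0 ∨ c = 1 := by revert c; decide
      rcases hc with rfl | rfl
      · have h2 := hadd m i 0 0
        rw [add_zero, St13.add_self2] at h2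
        rw [zero_smul, zero_smul]
        convert h2
      · rw [one_smul, one_smul]
end
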